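/- arXiv:math/0303372 — 3 statements merged into one kernel-verified Lean document; each statement's English description precedes it below -/
import Mathlib

section
/- Let U be a filtered k-algebra and g = {g_1,…,g_t} a sequence of mutually commuting elements of U such that the sequence of principal symbols ḡ = {ḡ_1,…,ḡ_t} is a complete intersection for gr U. Then (1) g is a complete intersection for U, and (2) if I = Ug_1 + … + Ug_t is the left ideal generated by g, then the associated graded ideal gr I of gr U equals (gr U)ḡ_1 + … + (gr U)ḡ_t. -/
open scoped TensorProduct

noncomputable section

universe u v w

/-- A sequence `g 0, …, g (t-1)` in a commutative ring is *regular* if for each `i`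
the class of `g i` in the quotient by the ideal generated by the previous elements
is neither a zero divisor nor invertible. -/
def IsRegularSequence {Λ : Type u} [CommRing Λ] {t : ℕ} (g : Fin t → Λ) : Prop :=
  ∀ i : Fin t,
    ((∀ x : Λ, g i * x ∈ Ideal.span (g '' {j | j < i}) → x ∈ Ideal.span (g '' {j | j < i})) ∧
      Ideal.span (g '' {j | j ≤ i}) ≠ ⊤)

/-- The `i`-th differential of the Koszul complex of a sequence `g` of elements in a
`k`-algebra `U`, where the `i`-th term of the complex is the free `U`-module on the
`i`-element subsets of `Fin t` (a model of `U ⊗ Λ^i k^t`), with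
`d (u ⊗ e_{j₁} ∧ … ∧ e_{jᵢ}) = Σ (-1)^(m-1) (u * g jₘ) ⊗ e_{j₁} ∧ … ∧ ê_{jₘ} ∧ … ∧ e_{jᵢ}`. -/
noncomputable def koszulD (k : Type u) {U : Type v} [CommRing k] [Ring U] [Algebra k U]
    {t : ℕ} (g : Fin t → U) (i : ℕ) :
    ({s : Finset (Fin t) // s.card = i + 1} →₀ U) →ₗ[k] ({s : Finset (Fin t) // s.card = i} →₀ U) :=
  Finsupp.lsum k fun s =>
    ∑ j ∈ s.1.attach,
      (Finsupp.lsingle (R := k)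
          (⟨s.1.erase j.1, by simp [Finset.card_erase_of_mem j.2, s.2]⟩ :
            {s : Finset (Fin t) // s.card = i})).comp
        (LinearMap.mulRight k (((-1 : U) ^ (s.1.filter fun a => a < j.1).card) * g j.1))

/-- A sequence `g` of (mutually commuting) elements of a `k`-algebra `U` is a
*complete intersection for `U`* if the Koszul homology `H_i(g, U)` vanishes for `i ≠ 0`
and `H_0(g, U) = U/(U g 0 + … + U g (t-1)) ≠ 0`. -/
def IsCompleteIntersection (k : Type u) {U : Type v} [CommRing k] [Ring U] [Algebra k U]
    {t : ℕ} (g : Fin t → U) : Prop :=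
  (∀ i : ℕ, LinearMap.ker (koszulD k g i) = LinearMap.range (koszulD k g (i + 1))) ∧
    Submodule.span U (Set.range g) ≠ ⊤

/-- `F` is an increasing exhausting algebra filtration of the `k`-algebra `U`,
with `F 0 = k·1`. -/
structure IsAlgebraFiltration {k : Type u} {U : Type v} [CommRing k] [Ring U] [Algebra k U]
    (F : ℕ → Submodule k U) : Prop where
  zero : F 0 = 1
  mono : Monotone F
  mul_le : ∀ i j, F i * F j ≤ F (i + j)
  exhaustive : (⨆ i, F i) = ⊤

/-- `(B, ℬ, π)` is a realization of the associated graded algebra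
`gr U = ⊕_{i≥0} U_i/U_{i-1}` of the filtered algebra `(U, F)`: `B` is a graded `k`-algebra
with grading `ℬ` and `π i : F i →ₗ[k] B` is the canonical projection of `F i` onto the
`i`-th graded piece `ℬ i ≅ F i / F (i-1)`; for `u ∈ F i \ F (i-1)` the element `π i u` is
the principal symbol `ū` of `u`. -/
structure IsAssociatedGraded {k : Type u} {U : Type v} {B : Type w} [CommRing k]
    [Ring U] [Algebra k U] [Ring B] [Algebra k B]
    (F : ℕ → Submodule k U) (ℬ : ℕ → Submodule k B) (π : ∀ i : ℕ, F i →ₗ[k] B) : Prop where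
  range_eq : ∀ i, LinearMap.range (π i) = ℬ i
  injective_zero : Function.Injective (π 0)
  ker_succ : ∀ (i : ℕ) (x : F (i + 1)), π (i + 1) x = 0 ↔ (x : U) ∈ F i
  map_one : ∀ h : (1 : U) ∈ F 0, π 0 ⟨1, h⟩ = 1
  map_mul : ∀ (i j : ℕ) (x : F i) (y : F j) (h : (x : U) * (y : U) ∈ F (i + j)),
    π (i + j) ⟨(x : U) * (y : U), h⟩ = π i x * π j y

/-- The associated graded (left) ideal `gr I ⊆ gr U` of a left ideal `I` of a filtered
algebra `U`: the span of the principal symbols of the elements of `I`. -/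
noncomputable def grLeftIdeal {k : Type u} {U : Type v} {B : Type w} [CommRing k]
    [Ring U] [Algebra k U] [Ring B] [Algebra k B]
    (F : ℕ → Submodule k U) (π : ∀ i : ℕ, F i →ₗ[k] B) (I : Submodule U U) :
    Submodule k B :=
  ⨆ i, Submodule.map (π i) ((I.restrictScalars k).comap (F i).subtype)

/-- The Koszul differential on all families indexed by finite subsets, in terms of coefficients. -/
def koszulCoeff {U : Type v} [Ring U] {t : ℕ} (g : Fin t → U) (x : Finset (Fin t) → U)
    (r : Finset (Fin t)) : U :=
  ∑ j ∈ rᶜ, x (insert j r) * ((-1 : U) ^ (r.filter fun a => a < j).card * g j)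

/-- Extension by zero of a chain of degree `i` to a family indexed by all finite subsets. -/
def koszulExtend {U : Type v} [Ring U] {t i : ℕ} (x : {s : Finset (Fin t) // s.card = i} →₀ U)
    (s : Finset (Fin t)) : U :=
  if h : s.card = i then x ⟨s, h⟩ else 0

section Koszul

variable {k : Type u} {U : Type v} [CommRing k] [Ring U] [Algebra k U] {t : ℕ}

theorem koszulCoeff_sub (g : Fin t → U) (x y : Finset (Fin t) → U) :
    koszulCoeff g (x - y) = koszulCoeff g x - koszulCoeff g y := by
  ext r
  simp [koszulCoeff, sub_mul, Finset.sum_sub_distrib]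

theorem koszulCoeff_add (g : Fin t → U) (x y : Finset (Fin t) → U) :
    koszulCoeff g (x + y) = koszulCoeff g x + koszulCoeff g y := by
  ext r
  simp [koszulCoeff, add_mul, Finset.sum_add_distrib]

theorem koszulCoeff_zero (g : Fin t → U) : koszulCoeff g 0 = 0 := by
  ext r
  simp [koszulCoeff]

theorem koszulExtend_add {i : ℕ} (x y : {s : Finset (Fin t) // s.card = i} →₀ U) :
    koszulExtend (x + y) = koszulExtend x + koszulExtend y := by
  ext s
  by_cases h : s.card = i <;> simp [koszulExtend, h]

theorem koszulExtend_zero {i : ℕ} :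
    koszulExtend (0 : {s : Finset (Fin t) // s.card = i} →₀ U) = 0 := by
  ext s
  simp [koszulExtend]

theorem koszulExtend_of_card_ne {i : ℕ} (x : {s : Finset (Fin t) // s.card = i} →₀ U)
    (s : Finset (Fin t)) (h : s.card ≠ i) : koszulExtend x s = 0 :=
  dif_neg h

theorem koszulExtend_injective {i : ℕ} :
    Function.Injective
      (koszulExtend : ({s : Finset (Fin t) // s.card = i} →₀ U) → Finset (Fin t) → U) := by
  intro x y h
  ext ⟨s, hs⟩
  simpa [koszulExtend, hs] using congrFun h s

theorem exists_koszulExtend_eq {i : ℕ} (x : Finset (Fin t) → U)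
    (hx : ∀ s, s.card ≠ i → x s = 0) :
    ∃ y : {s : Finset (Fin t) // s.card = i} →₀ U, koszulExtend y = x := by
  refine ⟨Finsupp.equivFunOnFinite.symm fun s => x s.1, ?_⟩
  ext s
  by_cases h : s.card = i
  · simp [koszulExtend, h]
  · simp [koszulExtend, h, hx s h]

theorem koszulCoeff_of_card_ne (g : Fin t → U) {i : ℕ} (x : Finset (Fin t) → U)
    (hx : ∀ s, s.card ≠ i + 1 → x s = 0) (r : Finset (Fin t)) (hr : r.card ≠ i) :
    koszulCoeff g x r = 0 := by
  refine Finset.sum_eq_zero fun j hj => ?_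
  rw [hx, zero_mul]
  rw [Finset.card_insert_of_notMem (Finset.mem_compl.1 hj)]
  omega

theorem koszulExtend_single {i : ℕ} (s : {s : Finset (Fin t) // s.card = i}) (a : U)
    (r : Finset (Fin t)) : koszulExtend (Finsupp.single s a) r = if s.1 = r then a else 0 := by
  obtain ⟨s, hs⟩ := s
  by_cases h : r.card = i
  · simp [koszulExtend, h, Finsupp.single_apply]
  · have : s ≠ r := by rintro rfl; exact h hs
    simp [koszulExtend, h, this]

theorem koszulExtend_sum {i : ℕ} {ι : Type*} (S : Finset ι)
    (f : ι → {s : Finset (Fin t) // s.card = i} →₀ U) (r : Finset (Fin t)) :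
    koszulExtend (∑ a ∈ S, f a) r = ∑ a ∈ S, koszulExtend (f a) r := by
  by_cases h : r.card = i <;> simp [koszulExtend, h, Finsupp.finsetSum_apply]

theorem koszulExtend_koszulD (g : Fin t → U) (i : ℕ)
    (x : {s : Finset (Fin t) // s.card = i + 1} →₀ U) :
    koszulExtend (koszulD k g i x) = koszulCoeff g (koszulExtend x) := by
  induction x using Finsupp.induction_linear with
  | zero => simp [koszulExtend_zero, koszulCoeff_zero]
  | add x y hx hy => rw [map_add, koszulExtend_add, hx, hy, koszulExtend_add, koszulCoeff_add]
  | single s a =>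
    ext r
    have h₁ : koszulD k g i (Finsupp.single s a) = ∑ j ∈ s.1.attach,
        Finsupp.single (⟨s.1.erase j.1, by simp [Finset.card_erase_of_mem j.2, s.2]⟩ :
            {s : Finset (Fin t) // s.card = i})
          (a * ((-1 : U) ^ (s.1.filter fun a => a < j.1).card * g j.1)) := by
      simp only [koszulD, Finsupp.lsum_single, LinearMap.sum_apply, LinearMap.comp_apply,
        Finsupp.lsingle_apply, LinearMap.mulRight_apply]
    rw [h₁, koszulExtend_sum]
    simp only [koszulExtend_single, koszulCoeff, ite_mul, zero_mul]
    rw [Finset.sum_attach s.1 (fun j => if s.1.erase j = r then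
      a * ((-1 : U) ^ (s.1.filter fun a => a < j).card * g j) else 0),
      ← Finset.sum_filter, ← Finset.sum_filter]
    refine Finset.sum_congr ?_ ?_
    · ext j
      simp only [Finset.mem_filter, Finset.mem_compl]
      constructor
      · rintro ⟨h, rfl⟩
        simp [h]
      · rintro ⟨h, h'⟩
        simp [h', h]
    · intro j hj
      simp only [Finset.mem_filter, Finset.mem_compl] at hj
      rw [hj.2, Finset.filter_insert, if_neg (lt_irrefl j)]

theorem koszulCoeff_koszulCoeff (g : Fin t → U) (hcomm : ∀ i j, Commute (g i) (g j))
    (x : Finset (Fin t) → U) : koszulCoeff g (koszulCoeff g x) = 0 := by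
  ext r
  simp only [koszulCoeff, Finset.sum_mul, Pi.zero_apply]
  rw [Finset.sum_sigma']
  refine Finset.sum_involution (fun p _ => ⟨p.2, p.1⟩) ?_ ?_ ?_ ?_
  · rintro ⟨j, l⟩ h
    simp only [Finset.mem_sigma, Finset.mem_compl, Finset.mem_insert, not_or] at h
    obtain ⟨hj, hlj, hl⟩ := h
    have hc : ∀ a b : Fin t, b ∉ r →
        ((insert b r).filter fun c => c < a).card
          = (r.filter fun c => c < a).card + if b < a then 1 else 0 := by
      intro a b hb
      rw [Finset.filter_insert]
      split_ifs
      · rw [Finset.card_insert_of_notMem (by simp [hb])]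
      · simp
    have hs : ∀ (a : U) (m n : ℕ), a * ((-1 : U) ^ m * g l) * ((-1 : U) ^ n * g j)
        = (-1 : U) ^ (m + n) * (a * (g l * g j)) := by
      intro a m n
      rcases Nat.even_or_odd m with hm | hm <;> rcases Nat.even_or_odd n with hn | hn <;>
        simp [pow_add, hm.neg_one_pow, hn.neg_one_pow, mul_assoc]
    have hs' : ∀ (a : U) (m n : ℕ), a * ((-1 : U) ^ m * g j) * ((-1 : U) ^ n * g l)
        = (-1 : U) ^ (m + n) * (a * (g l * g j)) := by
      intro a m n
      rw [(hcomm l j).eq]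
      rcases Nat.even_or_odd m with hm | hm <;> rcases Nat.even_or_odd n with hn | hn <;>
        simp [pow_add, hm.neg_one_pow, hn.neg_one_pow, mul_assoc]
    dsimp only
    rw [hs, hs', Finset.insert_comm j l, hc l j hj, hc j l hl, ← add_mul]
    generalize (r.filter fun c => c < l).card = p, (r.filter fun c => c < j).card = q
    rcases lt_or_gt_of_ne hlj with h | h <;>
      rcases Nat.even_or_odd p with hp | hp <;> rcases Nat.even_or_odd q with hq | hq <;>
        simp [h, h.not_gt, pow_add, hp.neg_one_pow, hq.neg_one_pow]
  · rintro ⟨j, l⟩ h _ he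
    simp only [Finset.mem_sigma, Finset.mem_compl, Finset.mem_insert, not_or] at h
    simp only [Sigma.mk.injEq] at he
    exact h.2.1 he.1
  · rintro ⟨j, l⟩ h
    simp only [Finset.mem_sigma, Finset.mem_compl, Finset.mem_insert, not_or] at h ⊢
    exact ⟨h.2.2, fun e => h.2.1 e.symm, h.1⟩
  · rintro ⟨j, l⟩ _
    rfl

theorem koszulD_ker_le_range_iff (g : Fin t → U) (i : ℕ) :
    LinearMap.ker (koszulD k g i) ≤ LinearMap.range (koszulD k g (i + 1)) ↔
      ∀ x : Finset (Fin t) → U, (∀ s, s.card ≠ i + 1 → x s = 0) → koszulCoeff g x = 0 →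
        ∃ y : Finset (Fin t) → U, (∀ s, s.card ≠ i + 2 → y s = 0) ∧ koszulCoeff g y = x := by
  constructor
  · intro h x hx h0
    obtain ⟨x, rfl⟩ := exists_koszulExtend_eq x hx
    have hk : x ∈ LinearMap.ker (koszulD k g i) := by
      apply koszulExtend_injective
      rw [koszulExtend_koszulD, h0, koszulExtend_zero]
    obtain ⟨y, rfl⟩ := h hk
    exact ⟨koszulExtend y, koszulExtend_of_card_ne y, (koszulExtend_koszulD g _ y).symm⟩
  · intro h x hx
    obtain ⟨y, hy, hyx⟩ := h (koszulExtend x) (koszulExtend_of_card_ne x) (by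
      rw [← koszulExtend_koszulD (k := k), LinearMap.mem_ker.1 hx, koszulExtend_zero])
    obtain ⟨y, rfl⟩ := exists_koszulExtend_eq y hy
    refine ⟨y, koszulExtend_injective ?_⟩
    rw [koszulExtend_koszulD, hyx]

theorem koszulD_range_le_ker (g : Fin t → U) (hcomm : ∀ i j, Commute (g i) (g j)) (i : ℕ) :
    LinearMap.range (koszulD k g (i + 1)) ≤ LinearMap.ker (koszulD k g i) := by
  rintro _ ⟨y, rfl⟩
  apply koszulExtend_injective
  rw [koszulExtend_koszulD, koszulExtend_koszulD, koszulCoeff_koszulCoeff g hcomm,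
    koszulExtend_zero]

theorem koszulCoeff_empty_mem_span (g : Fin t → U) (x : Finset (Fin t) → U) :
    koszulCoeff g x ∅ ∈ Submodule.span U (Set.range g) := by
  refine Submodule.sum_mem _ fun j _ => ?_
  rw [← mul_assoc]
  exact Submodule.smul_mem _ _ (Submodule.subset_span (Set.mem_range_self j))

theorem exists_koszulCoeff_empty_eq (g : Fin t → U) {u : U}
    (hu : u ∈ Submodule.span U (Set.range g)) :
    ∃ x : Finset (Fin t) → U, (∀ s, s.card ≠ 1 → x s = 0) ∧ koszulCoeff g x ∅ = u := by
  obtain ⟨c, rfl⟩ := (Submodule.mem_span_range_iff_exists_fun U).1 hu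
  refine ⟨fun s => if s.card = 1 then ∑ j ∈ s, c j else 0, fun s hs => if_neg hs, ?_⟩
  simp [koszulCoeff]

end Koszul

/-- The element `u` lies in the `n`-th step of the filtration `F`, extended by zero to negative
indices, and its image in the degree `n` part of the associated graded algebra is `b`. -/
def HasSymbol {k : Type u} {U : Type v} {B : Type w} [CommRing k]
    [Ring U] [Algebra k U] [Ring B] [Algebra k B]
    (F : ℕ → Submodule k U) (π : ∀ i : ℕ, F i →ₗ[k] B) (n : ℤ) (u : U) (b : B) : Prop :=
  (∃ (m : ℕ) (h : u ∈ F m), n = m ∧ π m ⟨u, h⟩ = b) ∨ (n < 0 ∧ u = 0 ∧ b = 0)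

namespace HasSymbol

variable {k : Type u} {U : Type v} {B : Type w} [CommRing k] [Ring U] [Algebra k U] [Ring B]
  [Algebra k B] {F : ℕ → Submodule k U} {ℬ : ℕ → Submodule k B} {π : ∀ i : ℕ, F i →ₗ[k] B}

theorem of_mem {m : ℕ} {u : U} (h : u ∈ F m) : HasSymbol F π m u (π m ⟨u, h⟩) :=
  Or.inl ⟨m, h, rfl, rfl⟩

theorem zero (n : ℤ) : HasSymbol F π n 0 0 := by
  rcases lt_or_ge n 0 with h | h
  · exact Or.inr ⟨h, rfl, rfl⟩
  · lift n to ℕ using h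
    exact Or.inl ⟨n, zero_mem _, rfl, map_zero (π n)⟩

theorem add {n : ℤ} {u v : U} {b c : B} (hu : HasSymbol F π n u b) (hv : HasSymbol F π n v c) :
    HasSymbol F π n (u + v) (b + c) := by
  rcases hu with ⟨m, h, rfl, rfl⟩ | ⟨hn, rfl, rfl⟩
  · rcases hv with ⟨m', h', e, rfl⟩ | ⟨hn, -, -⟩
    · obtain rfl : m = m' := by exact_mod_cast e
      exact Or.inl ⟨m, add_mem h h', rfl, map_add (π m) ⟨u, h⟩ ⟨v, h'⟩⟩
    · omega
  · simpa using hv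

theorem neg {n : ℤ} {u : U} {b : B} (hu : HasSymbol F π n u b) : HasSymbol F π n (-u) (-b) := by
  rcases hu with ⟨m, h, rfl, rfl⟩ | ⟨hn, rfl, rfl⟩
  · exact Or.inl ⟨m, neg_mem h, rfl, map_neg (π m) ⟨u, h⟩⟩
  · simpa using zero n

theorem sub {n : ℤ} {u v : U} {b c : B} (hu : HasSymbol F π n u b) (hv : HasSymbol F π n v c) :
    HasSymbol F π n (u - v) (b - c) := by
  simpa [sub_eq_add_neg] using hu.add hv.neg

theorem sum {ι : Type*} {n : ℤ} (S : Finset ι) {u : ι → U} {b : ι → B}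
    (h : ∀ a ∈ S, HasSymbol F π n (u a) (b a)) :
    HasSymbol F π n (∑ a ∈ S, u a) (∑ a ∈ S, b a) := by
  classical
  induction S using Finset.induction_on with
  | empty => simpa using zero n
  | insert a S ha ih =>
    rw [Finset.sum_insert ha, Finset.sum_insert ha]
    exact (h a (by simp)).add (ih fun c hc => h c (by simp [hc]))

theorem neg_one_pow_mul {n : ℤ} {u : U} {b : B} (hu : HasSymbol F π n u b) (e : ℕ) :
    HasSymbol F π n ((-1) ^ e * u) ((-1) ^ e * b) := by
  rcases Nat.even_or_odd e with h | h
  · simpa [h.neg_one_pow] using hu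
  · simpa [h.neg_one_pow] using hu.neg

theorem mul (hF : IsAlgebraFiltration F) (hπ : IsAssociatedGraded F ℬ π) {n m : ℤ} {u v : U}
    {b c : B} (hu : HasSymbol F π n u b) (hv : HasSymbol F π m v c) :
    HasSymbol F π (n + m) (u * v) (b * c) := by
  rcases hu with ⟨i, h, rfl, rfl⟩ | ⟨-, rfl, rfl⟩
  · rcases hv with ⟨j, h', rfl, rfl⟩ | ⟨-, rfl, rfl⟩
    · have huv : u * v ∈ F (i + j) := hF.mul_le i j (Submodule.mul_mem_mul h h')
      exact Or.inl ⟨i + j, huv, by push_cast; rfl, hπ.map_mul i j ⟨u, h⟩ ⟨v, h'⟩ huv⟩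
    · simpa using zero (F := F) (π := π) ((i : ℤ) + m)
  · simpa using zero (F := F) (π := π) (n + m)

theorem unique {n : ℤ} {u : U} {b c : B} (hb : HasSymbol F π n u b) (hc : HasSymbol F π n u c) :
    b = c := by
  rcases hb with ⟨i, h, rfl, rfl⟩ | ⟨hn, rfl, rfl⟩
  · rcases hc with ⟨j, h', e, rfl⟩ | ⟨hn, -, -⟩
    · obtain rfl : i = j := by exact_mod_cast e
      rfl
    · omega
  · rcases hc with ⟨j, h', e, rfl⟩ | ⟨-, -, rfl⟩
    · omega
    · rfl

theorem mem_of_natCast {n : ℕ} {u : U} {b : B} (hb : HasSymbol F π n u b) : u ∈ F n := by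
  rcases hb with ⟨i, h, e, rfl⟩ | ⟨hn, -, -⟩
  · obtain rfl : n = i := by exact_mod_cast e
    exact h
  · omega

theorem eq_zero_of_neg {n : ℤ} {u : U} {b : B} (hb : HasSymbol F π n u b) (hn : n < 0) :
    u = 0 := by
  rcases hb with ⟨i, h, rfl, rfl⟩ | ⟨-, rfl, -⟩
  · omega
  · rfl

theorem zero_iff (hF : IsAlgebraFiltration F) (hπ : IsAssociatedGraded F ℬ π) {n : ℤ} {u : U} :
    HasSymbol F π n u 0 ↔ ∃ b, HasSymbol F π (n - 1) u b := by
  constructor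
  · rintro (⟨m, h, rfl, h0⟩ | ⟨hn, rfl, -⟩)
    · cases m with
      | zero =>
        have : (⟨u, h⟩ : F 0) = 0 := hπ.injective_zero (h0.trans (map_zero (π 0)).symm)
        obtain rfl : u = 0 := congrArg Subtype.val this
        exact ⟨0, zero _⟩
      | succ m =>
        have hm : u ∈ F m := (hπ.ker_succ m ⟨u, h⟩).1 h0
        exact ⟨π m ⟨u, hm⟩, Or.inl ⟨m, hm, by push_cast; ring, rfl⟩⟩
    · exact ⟨0, zero _⟩
  · rintro ⟨b, ⟨m, h, hn, -⟩ | ⟨hn, rfl, -⟩⟩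
    · obtain rfl : n = ((m + 1 : ℕ) : ℤ) := by push_cast; omega
      have hm : u ∈ F (m + 1) := hF.mono m.le_succ h
      exact Or.inl ⟨m + 1, hm, rfl, (hπ.ker_succ m ⟨u, hm⟩).2 h⟩
    · exact zero _

theorem add_nat (hF : IsAlgebraFiltration F) (hπ : IsAssociatedGraded F ℬ π) {n : ℤ} {u : U} {b : B}
    (hu : HasSymbol F π n u b) (N : ℕ) : ∃ c, HasSymbol F π (n + N) u c := by
  induction N with
  | zero => exact ⟨b, by simpa using hu⟩
  | succ N ih =>
    refine ⟨0, (zero_iff hF hπ).2 ?_⟩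
    convert ih using 4
    push_cast
    ring

theorem exists_of_mem (hπ : IsAssociatedGraded F ℬ π) {m : ℕ} {b : B} (hb : b ∈ ℬ m) :
    ∃ u, HasSymbol F π m u b := by
  rw [← hπ.range_eq] at hb
  obtain ⟨u, rfl⟩ := hb
  exact ⟨u, of_mem u.2⟩

end HasSymbol

namespace IsAssociatedGraded

variable {k : Type u} {U : Type v} {B : Type w} [CommRing k] [Ring U] [Algebra k U] [Ring B]
  [Algebra k B] {F : ℕ → Submodule k U} {ℬ : ℕ → Submodule k B} {π : ∀ i : ℕ, F i →ₗ[k] B}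

/-- Multiplication by homogeneous elements of degrees `d j` commutes with taking homogeneous
components, so any preimage of a homogeneous Koszul boundary may be chosen to be homogeneous and
hence lifted to the filtered algebra. -/
theorem exists_koszulCoeff_lift [GradedAlgebra ℬ] (hπ : IsAssociatedGraded F ℬ π) {t : ℕ}
    {h : Fin t → B} {d : Fin t → ℕ} (hd : ∀ j, h j ∈ ℬ (d j)) {n : ℤ}
    {x : Finset (Fin t) → U} {X : Finset (Fin t) → B}
    (hX : ∀ s, HasSymbol F π (n - ∑ j ∈ s, (d j : ℤ)) (x s) (X s)) {i : ℕ}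
    {Y : Finset (Fin t) → B} (hY : ∀ s, s.card ≠ i → Y s = 0) (hYX : koszulCoeff h Y = X) :
    ∃ (z : Finset (Fin t) → U) (Z : Finset (Fin t) → B), (∀ s, s.card ≠ i → z s = 0) ∧
      (∀ s, HasSymbol F π (n - ∑ j ∈ s, (d j : ℤ)) (z s) (Z s)) ∧ koszulCoeff h Z = X := by
  classical
  let c : ℤ → B → B := fun m b => if 0 ≤ m then (DirectSum.decompose ℬ b m.toNat : B) else 0
  have hc0 : ∀ m, c m 0 = 0 := fun m => by simp [c]
  have hlift : ∀ m b, ∃ u, HasSymbol F π m u (c m b) := by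
    intro m b
    by_cases hm : 0 ≤ m
    · lift m to ℕ using hm
      simpa [c] using HasSymbol.exists_of_mem hπ (DirectSum.decompose ℬ b m).2
    · exact ⟨0, by simpa [c, hm] using HasSymbol.zero m⟩
  have hcsymb : ∀ m u b, HasSymbol F π m u b → c m b = b := by
    rintro m u b (⟨p, hp, rfl, rfl⟩ | ⟨hn, -, rfl⟩)
    · have : π p ⟨u, hp⟩ ∈ ℬ p := hπ.range_eq p ▸ LinearMap.mem_range_self _ _
      simpa [c] using DirectSum.decompose_of_mem_same ℬ this
    · exact hc0 m
  have hcsum : ∀ (m : ℤ) (S : Finset (Fin t)) (f : Fin t → B),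
      c m (∑ j ∈ S, f j) = ∑ j ∈ S, c m (f j) := by
    intro m S f
    by_cases hm : 0 ≤ m
    · simp [c, hm, DirectSum.decompose_sum]
    · simp [c, hm]
  have hcmul : ∀ (m : ℤ) (b a : B) (p : ℕ), a ∈ ℬ p → c m (b * a) = c (m - p) b * a := by
    intro m b a p ha
    by_cases hm : 0 ≤ m
    · lift m to ℕ using hm
      by_cases hpm : p ≤ m
      · have h₁ : (0 : ℤ) ≤ (m : ℤ) - p := by omega
        have h₂ : ((m : ℤ) - p).toNat = m - p := by omega
        simp only [c, h₁, if_true, Int.natCast_nonneg, Int.toNat_natCast]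
        rw [h₂]
        exact DirectSum.coe_decompose_mul_of_right_mem_of_le ℬ ha hpm
      · have h₁ : ¬ (0 : ℤ) ≤ (m : ℤ) - p := by omega
        simp only [c, h₁, if_true, if_false, Int.natCast_nonneg, Int.toNat_natCast, zero_mul]
        exact DirectSum.coe_decompose_mul_of_right_mem_of_not_le ℬ ha hpm
    · have h₁ : ¬ (0 : ℤ) ≤ m - p := by omega
      simp only [c, hm, h₁, if_false, zero_mul]
  choose L hL using hlift
  refine ⟨fun s => if s.card = i then L (n - ∑ j ∈ s, (d j : ℤ)) (Y s) else 0,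
    fun s => c (n - ∑ j ∈ s, (d j : ℤ)) (Y s), fun s hs => if_neg hs, fun s => ?_, ?_⟩
  · dsimp only
    split_ifs with hs
    · exact hL _ _
    · rw [hY s hs, hc0]
      exact HasSymbol.zero _
  · ext r
    rw [← hcsymb _ _ _ (hX r), ← hYX, koszulCoeff, koszulCoeff, hcsum]
    refine Finset.sum_congr rfl fun j hj => ?_
    have hmem : (-1 : B) ^ (r.filter fun a => a < j).card * h j ∈ ℬ (d j) := by
      rcases Nat.even_or_odd (r.filter fun a => a < j).card with he | he
      · simpa [he.neg_one_pow] using hd j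
      · simpa [he.neg_one_pow] using hd j
    rw [hcmul _ _ _ _ hmem, Finset.sum_insert (Finset.mem_compl.1 hj)]
    congr 2
    ring

theorem hasSymbol_koszulCoeff (hF : IsAlgebraFiltration F) (hπ : IsAssociatedGraded F ℬ π) {t : ℕ}
    {g : Fin t → U} {h : Fin t → B} {d : Fin t → ℕ} (hg : ∀ j, HasSymbol F π (d j) (g j) (h j))
    {n : ℤ} {x : Finset (Fin t) → U} {X : Finset (Fin t) → B}
    (hX : ∀ s, HasSymbol F π (n - ∑ j ∈ s, (d j : ℤ)) (x s) (X s)) (r : Finset (Fin t)) :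
    HasSymbol F π (n - ∑ j ∈ r, (d j : ℤ)) (koszulCoeff g x r) (koszulCoeff h X r) := by
  refine HasSymbol.sum _ fun j hj => ?_
  have hm := HasSymbol.mul hF hπ (hX (insert j r))
    ((hg j).neg_one_pow_mul (r.filter fun a => a < j).card)
  rw [Finset.sum_insert (Finset.mem_compl.1 hj)] at hm
  convert hm using 1
  ring

/-- If the boundary of a Koszul chain lies in filtration degree `n`, then modulo boundaries the
chain itself can be moved into filtration degree `n`. -/
theorem exists_sub_koszulCoeff_hasSymbol [GradedAlgebra ℬ] (hF : IsAlgebraFiltration F)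
    (hπ : IsAssociatedGraded F ℬ π) {t : ℕ} {g : Fin t → U}
    (hcomm : ∀ i j, Commute (g i) (g j)) {h : Fin t → B} {d : Fin t → ℕ}
    (hg : ∀ j, HasSymbol F π (d j) (g j) (h j)) {i : ℕ}
    (hex : ∀ X : Finset (Fin t) → B, (∀ s, s.card ≠ i + 1 → X s = 0) → koszulCoeff h X = 0 →
      ∃ Y : Finset (Fin t) → B, (∀ s, s.card ≠ i + 2 → Y s = 0) ∧ koszulCoeff h Y = X)
    {n : ℤ} {x : Finset (Fin t) → U} (hx : ∀ s, s.card ≠ i + 1 → x s = 0)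
    (hdx : ∀ s, ∃ b, HasSymbol F π (n - ∑ j ∈ s, (d j : ℤ)) (koszulCoeff g x s) b) :
    ∃ (y : Finset (Fin t) → U) (X : Finset (Fin t) → B), (∀ s, s.card ≠ i + 2 → y s = 0) ∧
      ∀ s, HasSymbol F π (n - ∑ j ∈ s, (d j : ℤ)) ((x - koszulCoeff g y) s) (X s) := by
  have hd : ∀ j, h j ∈ ℬ (d j) := by
    intro j
    have := HasSymbol.of_mem (π := π) (HasSymbol.mem_of_natCast (hg j))
    rw [(hg j).unique this, ← hπ.range_eq]
    exact LinearMap.mem_range_self _ _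
  have key : ∀ (N : ℕ) (x : Finset (Fin t) → U) (X : Finset (Fin t) → B),
      (∀ s, s.card ≠ i + 1 → x s = 0) →
      (∀ s, ∃ b, HasSymbol F π (n - ∑ j ∈ s, (d j : ℤ)) (koszulCoeff g x s) b) →
      (∀ s, HasSymbol F π (n + N - ∑ j ∈ s, (d j : ℤ)) (x s) (X s)) →
      ∃ (y : Finset (Fin t) → U) (X : Finset (Fin t) → B), (∀ s, s.card ≠ i + 2 → y s = 0) ∧
        ∀ s, HasSymbol F π (n - ∑ j ∈ s, (d j : ℤ)) ((x - koszulCoeff g y) s) (X s) := by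
    intro N
    induction N with
    | zero =>
      intro x X _ _ hX
      exact ⟨0, X, fun _ _ => rfl, by simpa [koszulCoeff_zero] using hX⟩
    | succ N ih =>
      intro x X hx hdx hX
      have hX0 : ∀ s, s.card ≠ i + 1 → X s = 0 := by
        intro s hs
        have := hX s
        rw [hx s hs] at this
        exact this.unique (HasSymbol.zero _)
      have hdX : koszulCoeff h X = 0 := by
        ext r
        refine (hasSymbol_koszulCoeff hF hπ hg hX r).unique ((HasSymbol.zero_iff hF hπ).2 ?_)
        obtain ⟨b, hb⟩ := hdx r
        obtain ⟨b', hb'⟩ := hb.add_nat hF hπ N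
        refine ⟨b', ?_⟩
        convert hb' using 1
        push_cast
        ring
      obtain ⟨Y, hY, hYX⟩ := hex X hX0 hdX
      obtain ⟨z, Z, hz, hZ, hZX⟩ := exists_koszulCoeff_lift hπ hd hX hY hYX
      have hlow : ∀ s, ∃ b, HasSymbol F π (n + N - ∑ j ∈ s, (d j : ℤ))
          ((x - koszulCoeff g z) s) b := by
        intro s
        have hs := (hX s).sub (hasSymbol_koszulCoeff hF hπ hg hZ s)
        rw [hZX, sub_self, HasSymbol.zero_iff hF hπ] at hs
        obtain ⟨b, hb⟩ := hs
        refine ⟨b, ?_⟩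
        rw [Pi.sub_apply]
        convert hb using 1
        push_cast
        ring
      choose X' hX' using hlow
      obtain ⟨y, X'', hy, hX''⟩ := ih (x - koszulCoeff g z) X' (by
          intro s hs
          rw [Pi.sub_apply, hx s hs, koszulCoeff_of_card_ne g z hz s hs, sub_zero])
        (by rwa [koszulCoeff_sub, koszulCoeff_koszulCoeff g hcomm, sub_zero]) hX'
      refine ⟨z + y, X'', fun s hs => by simp [hz s hs, hy s hs], ?_⟩
      rwa [koszulCoeff_add, ← sub_sub]
  obtain ⟨N, X, hN⟩ : ∃ (N : ℕ) (X : Finset (Fin t) → B),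
      ∀ s, HasSymbol F π (n + N - ∑ j ∈ s, (d j : ℤ)) (x s) (X s) := by
    have hmem : ∀ s, ∃ m, x s ∈ F m := fun s =>
      (Submodule.mem_iSup_of_directed F hF.mono.directed_le).1
        (hF.exhaustive ▸ Submodule.mem_top)
    choose m hm using hmem
    let N : ℕ := ∑ s, m s + ∑ j, d j + n.natAbs
    have hlift : ∀ s, ∃ b, HasSymbol F π (n + N - ∑ j ∈ s, (d j : ℤ)) (x s) b := by
      intro s
      have h₁ : m s ≤ ∑ s, m s := Finset.single_le_sum (fun _ _ => Nat.zero_le _)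
        (Finset.mem_univ s)
      have h₂ : ∑ j ∈ s, d j ≤ ∑ j, d j := Finset.sum_le_sum_of_subset (Finset.subset_univ s)
      have h₃ : ((∑ j ∈ s, d j : ℕ) : ℤ) = ∑ j ∈ s, (d j : ℤ) := by push_cast; rfl
      have h₄ : m s ≤ (n + N - ∑ j ∈ s, (d j : ℤ)).toNat := by
        rw [← h₃]
        omega
      have h₅ : n + N - ∑ j ∈ s, (d j : ℤ) = (n + N - ∑ j ∈ s, (d j : ℤ)).toNat := by
        rw [← h₃]
        omega
      rw [h₅]
      exact ⟨_, HasSymbol.of_mem (hF.mono h₄ (hm s))⟩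
    choose X hX using hlift
    exact ⟨N, X, hX⟩
  exact key N x X hx hdx hN

end IsAssociatedGraded

/-- Let `U` be a filtered `k`-algebra and `g = {g 1, …, g t}` a sequence of
mutually commuting elements of `U` such that the sequence of principal symbols
`ḡ = {ḡ 1, …, ḡ t}` is a complete intersection for `gr U`. Then (1) `g` is a complete
intersection for `U`, and (2) if `I = U g 1 + … + U g t`, then `gr I = (gr U) ḡ 1 + … +
(gr U) ḡ t`. -/
theorem statement4 {k : Type u} {U : Type v} {B : Type w} [Field k] [IsAlgClosed k]
    [CharZero k] [Ring U] [Algebra k U] [Ring B] [Algebra k B]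
    (F : ℕ → Submodule k U) (hF : IsAlgebraFiltration F)
    (ℬ : ℕ → Submodule k B) [GradedAlgebra ℬ] (π : ∀ i : ℕ, F i →ₗ[k] B)
    (hπ : IsAssociatedGraded F ℬ π)
    {t : ℕ} (g : Fin t → U) (hcomm : ∀ i j, Commute (g i) (g j))
    (d : Fin t → ℕ) (hdF : ∀ i, g i ∈ F (d i))
    (hne : ∀ i, π (d i) ⟨g i, hdF i⟩ ≠ 0)
    (hCI : IsCompleteIntersection k (fun i => π (d i) ⟨g i, hdF i⟩)) :
    IsCompleteIntersection k g ∧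
      grLeftIdeal F π (Submodule.span U (Set.range g)) =
        (Submodule.span B (Set.range fun i => π (d i) ⟨g i, hdF i⟩)).restrictScalars k := by
  classical
  have hg : ∀ j, HasSymbol F π (d j) (g j) (π (d j) ⟨g j, hdF j⟩) :=
    fun j => HasSymbol.of_mem (hdF j)
  obtain ⟨hexact, hproper⟩ := hCI
  have hex := fun i => (koszulD_ker_le_range_iff (k := k)
    (fun j => π (d j) ⟨g j, hdF j⟩) i).1 (hexact i).le
  have hsymb : ∀ (n : ℕ) (u : F n), (u : U) ∈ Submodule.span U (Set.range g) →
      π n u ∈ Submodule.span B (Set.range fun j => π (d j) ⟨g j, hdF j⟩) := by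
    intro n u hu
    obtain ⟨x, hx, hxu⟩ := exists_koszulCoeff_empty_eq g hu
    obtain ⟨y, X, hy, hX⟩ := hπ.exists_sub_koszulCoeff_hasSymbol hF hcomm hg (hex 0)
      (n := n) (x := x) hx (by
        intro s
        by_cases hs : s.card = 0
        · obtain rfl := Finset.card_eq_zero.1 hs
          rw [hxu]
          exact ⟨π n u, by simpa using HasSymbol.of_mem (π := π) u.2⟩
        · rw [koszulCoeff_of_card_ne g x hx s hs]
          exact ⟨0, HasSymbol.zero _⟩)
    have h₁ := hπ.hasSymbol_koszulCoeff hF hg hX ∅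
    rw [koszulCoeff_sub, koszulCoeff_koszulCoeff g hcomm, sub_zero, hxu, Finset.sum_empty,
      sub_zero] at h₁
    rw [(HasSymbol.of_mem (π := π) u.2).unique h₁]
    exact koszulCoeff_empty_mem_span _ X
  refine ⟨⟨fun i => le_antisymm ?_ (koszulD_range_le_ker g hcomm i), fun htop => ?_⟩, ?_⟩
  · rw [koszulD_ker_le_range_iff]
    intro x hx h0
    obtain ⟨y, X, hy, hX⟩ := hπ.exists_sub_koszulCoeff_hasSymbol hF hcomm hg (hex i)
      (n := -1) hx (by
        intro s
        rw [h0]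
        exact ⟨0, HasSymbol.zero _⟩)
    refine ⟨y, hy, (sub_eq_zero.1 (funext fun s => (hX s).eq_zero_of_neg ?_)).symm⟩
    have : 0 ≤ ∑ j ∈ s, (d j : ℤ) := Finset.sum_nonneg fun _ _ => Int.natCast_nonneg _
    omega
  · have h1 : (1 : U) ∈ F 0 := hF.zero ▸ Submodule.one_le.1 le_rfl
    have := hsymb 0 ⟨1, h1⟩ (htop ▸ Submodule.mem_top)
    rw [hπ.map_one h1] at this
    exact hproper ((Ideal.eq_top_iff_one _).2 this)
  · refine le_antisymm (iSup_le fun n => ?_) fun b hb => ?_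
    · rintro _ ⟨u, hu, rfl⟩
      exact hsymb n u hu
    · rw [Submodule.restrictScalars_mem, Submodule.mem_span_range_iff_exists_fun] at hb
      obtain ⟨c, rfl⟩ := hb
      refine Submodule.sum_mem _ fun j _ => ?_
      rw [smul_eq_mul, ← DirectSum.sum_support_decompose ℬ (c j), Finset.sum_mul]
      refine Submodule.sum_mem _ fun n _ => ?_
      obtain ⟨u, hu⟩ := (hπ.range_eq n).ge (DirectSum.decompose ℬ (c j) n).2
      have huv : (u : U) * g j ∈ F (n + d j) :=
        hF.mul_le n (d j) (Submodule.mul_mem_mul u.2 (hdF j))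
      rw [← hu, ← hπ.map_mul n (d j) u ⟨g j, hdF j⟩ huv]
      refine Submodule.mem_iSup_of_mem (n + d j) ⟨_, ?_, rfl⟩
      exact Submodule.smul_mem _ (u : U) (Submodule.subset_span (Set.mem_range_self j))

end
end

section
/- Let Λ be a graded affine k-algebra equipped with its associated filtration Λ_i = ⊕_{j≤i} Λ_(j), and let g = {g_1,…,g_t} ⊆ Λ be a sequence such that the sequence of principal symbols ḡ = {ḡ_1,…,ḡ_t} (top-degree homogeneous components) is a complete intersection for Λ. Then g is a regular sequence in Λ. -/
open scoped TensorProduct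

noncomputable section

universe u v w

section Truncation

variable {k : Type u} {Λ : Type v} [Field k] [CommRing Λ] [Algebra k Λ]
  (𝒜 : ℕ → Submodule k Λ) [GradedAlgebra 𝒜]

/-- The sum of the homogeneous components of `x` of degree less than `e`. -/
def homogeneousTrunc (e : ℕ) (x : Λ) : Λ :=
  ∑ l ∈ Finset.range e, GradedRing.proj 𝒜 l x

variable {𝒜}

theorem GradedRing.ext_proj {x y : Λ} (h : ∀ n, GradedRing.proj 𝒜 n x = GradedRing.proj 𝒜 n y) :
    x = y := by
  apply (DirectSum.decompose 𝒜).injective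
  ext n
  exact h n

theorem GradedRing.proj_mem (n : ℕ) (x : Λ) : GradedRing.proj 𝒜 n x ∈ 𝒜 n :=
  (DirectSum.decompose 𝒜 x n).2

theorem GradedRing.proj_of_mem {m : ℕ} (n : ℕ) {x : Λ} (hx : x ∈ 𝒜 m) :
    GradedRing.proj 𝒜 n x = if n = m then x else 0 := by
  split_ifs with h
  · subst h
    exact DirectSum.decompose_of_mem_same 𝒜 hx
  · exact DirectSum.decompose_of_mem_ne 𝒜 hx (Ne.symm h)

theorem GradedRing.proj_mul_of_right_mem {q : ℕ} (n : ℕ) (x : Λ) {h : Λ} (hh : h ∈ 𝒜 q) :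
    GradedRing.proj 𝒜 n (x * h) = if q ≤ n then GradedRing.proj 𝒜 (n - q) x * h else 0 := by
  simpa [GradedRing.proj_apply] using DirectSum.coe_decompose_mul_of_right_mem 𝒜 n (a := x) hh

theorem GradedRing.exists_forall_le_proj_eq_zero (x : Λ) :
    ∃ N, ∀ n, N ≤ n → GradedRing.proj 𝒜 n x = 0 := by
  classical
  refine ⟨(DirectSum.decompose 𝒜 x).support.sup id + 1, fun n hn => ?_⟩
  by_contra h
  have hmem : n ∈ (DirectSum.decompose 𝒜 x).support := by
    rw [DFinsupp.mem_support_iff]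
    intro h'
    exact h (by rw [GradedRing.proj_apply, h']; rfl)
  have := Finset.le_sup (f := id) hmem
  simp only [id] at this
  omega

theorem proj_homogeneousTrunc (n e : ℕ) (x : Λ) :
    GradedRing.proj 𝒜 n (homogeneousTrunc 𝒜 e x) =
      if n < e then GradedRing.proj 𝒜 n x else 0 := by
  simp only [homogeneousTrunc, map_sum, GradedRing.proj_of_mem n (GradedRing.proj_mem _ x)]
  rw [Finset.sum_ite_eq]
  simp

theorem homogeneousTrunc_zero_left (x : Λ) : homogeneousTrunc 𝒜 0 x = 0 := by
  simp [homogeneousTrunc]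

theorem homogeneousTrunc_zero (e : ℕ) : homogeneousTrunc 𝒜 e 0 = 0 := by
  simp [homogeneousTrunc]

theorem homogeneousTrunc_neg (e : ℕ) (x : Λ) :
    homogeneousTrunc 𝒜 e (-x) = -homogeneousTrunc 𝒜 e x := by
  simp only [homogeneousTrunc, map_neg, Finset.sum_neg_distrib]

theorem homogeneousTrunc_eq_self {e : ℕ} {x : Λ} (hx : ∀ n, e ≤ n → GradedRing.proj 𝒜 n x = 0) :
    homogeneousTrunc 𝒜 e x = x := by
  refine GradedRing.ext_proj (𝒜 := 𝒜) fun n => ?_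
  rw [proj_homogeneousTrunc]
  split_ifs with h
  · rfl
  · exact (hx n (not_lt.1 h)).symm

theorem proj_homogeneousTrunc_mul_of_mem {q : ℕ} (n e : ℕ) (x : Λ) {h : Λ} (hh : h ∈ 𝒜 q) :
    GradedRing.proj 𝒜 n (homogeneousTrunc 𝒜 (e - q) x * h) =
      if n < e then GradedRing.proj 𝒜 n (x * h) else 0 := by
  rw [GradedRing.proj_mul_of_right_mem n _ hh, GradedRing.proj_mul_of_right_mem n _ hh,
    proj_homogeneousTrunc]
  split_ifs <;> first | rfl | omega | simp

theorem proj_homogeneousTrunc_mul_eq_zero {n p q : ℕ} (x : Λ) {r : Λ}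
    (hr : ∀ m, q ≤ m → GradedRing.proj 𝒜 m r = 0) (hn : p + q ≤ n + 1) :
    GradedRing.proj 𝒜 n (homogeneousTrunc 𝒜 p x * r) = 0 := by
  rw [homogeneousTrunc, Finset.sum_mul, map_sum]
  refine Finset.sum_eq_zero fun l hl => ?_
  rw [Finset.mem_range] at hl
  rw [mul_comm, GradedRing.proj_mul_of_right_mem n r (GradedRing.proj_mem l x),
    hr _ (by omega), zero_mul, ite_self]

theorem proj_homogeneousTrunc_mul {q : ℕ} {n e : ℕ} (x : Λ) {y : Λ}
    (hy : ∀ m, q < m → GradedRing.proj 𝒜 m y = 0) (hn : e ≤ n + 1) :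
    GradedRing.proj 𝒜 n (homogeneousTrunc 𝒜 (e - q) x * y) =
      if n < e then GradedRing.proj 𝒜 n (x * GradedRing.proj 𝒜 q y) else 0 := by
  have hr : ∀ m, q ≤ m → GradedRing.proj 𝒜 m (y - GradedRing.proj 𝒜 q y) = 0 := by
    intro m hm
    rw [map_sub, GradedRing.proj_of_mem m (GradedRing.proj_mem q y)]
    split_ifs with h
    · rw [h, sub_self]
    · rw [hy m (by omega), sub_zero]
  have hz : GradedRing.proj 𝒜 n
      (homogeneousTrunc 𝒜 (e - q) x * (y - GradedRing.proj 𝒜 q y)) = 0 := by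
    rcases le_total q e with h | h
    · exact proj_homogeneousTrunc_mul_eq_zero x hr (by omega)
    · rw [Nat.sub_eq_zero_of_le h, homogeneousTrunc_zero_left, zero_mul, map_zero]
  rw [mul_sub, map_sub, sub_eq_zero] at hz
  rw [hz, proj_homogeneousTrunc_mul_of_mem n e x (GradedRing.proj_mem q y)]

end Truncation

section Relations

variable {ι : Type w} {Λ : Type v} [CommRing Λ]

/-- A square array is alternating if it is antisymmetric with zero diagonal. -/
def IsAlternating (c : ι → ι → Λ) : Prop :=
  (∀ i, c i i = 0) ∧ ∀ i j, c i j = -c j i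

/-- Every linear relation between the `h i` with `i ∈ S` is a combination of the
trivial relations `h i * h j - h j * h i = 0`, i.e. the first Koszul homology vanishes. -/
def OnlyTrivialRelations (h : ι → Λ) (S : Finset ι) : Prop :=
  ∀ a : ι → Λ, ∑ i ∈ S, a i * h i = 0 →
    ∃ c : ι → ι → Λ, IsAlternating c ∧ ∀ i ∈ S, a i = ∑ j ∈ S, c i j * h j

theorem IsAlternating.zero : IsAlternating (fun _ _ : ι => (0 : Λ)) :=
  ⟨fun _ => rfl, fun _ _ => neg_zero.symm⟩

theorem IsAlternating.add {c e : ι → ι → Λ} (hc : IsAlternating c) (he : IsAlternating e) :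
    IsAlternating (fun i j => c i j + e i j) :=
  ⟨fun i => by simp [hc.1 i, he.1 i], fun i j => by beta_reduce; rw [hc.2 i j, he.2 i j]; ring⟩

theorem IsAlternating.mul_left {c : ι → ι → Λ} (hc : IsAlternating c) (r : Λ) :
    IsAlternating (fun i j => r * c i j) :=
  ⟨fun i => by simp [hc.1 i], fun i j => by beta_reduce; rw [hc.2 i j]; ring⟩

theorem IsAlternating.sum_eq_zero {c : ι → ι → Λ} (hc : IsAlternating c) (g : ι → Λ)
    (S : Finset ι) : ∑ i ∈ S, (∑ j ∈ S, c i j * g j) * g i = 0 := by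
  simp only [Finset.sum_mul]
  rw [← Finset.sum_product']
  refine Finset.sum_involution (fun p _ => p.swap) ?_ ?_ ?_ ?_
  · rintro ⟨i, j⟩ -
    simp only [Prod.swap]
    rw [hc.2 i j]
    ring
  · rintro ⟨i, j⟩ - hne heq
    simp only [Prod.swap, Prod.mk.injEq] at heq
    apply hne
    simp [heq.1, hc.1]
  · rintro ⟨i, j⟩ h
    simpa [and_comm] using h
  · rintro ⟨i, j⟩ -
    rfl

theorem OnlyTrivialRelations.mem_span [DecidableEq ι] {g : ι → Λ} {S : Finset ι} {s : ι}
    (hs : s ∉ S) (hg : OnlyTrivialRelations g (insert s S)) {x : Λ}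
    (hx : g s * x ∈ Ideal.span (g '' S)) : x ∈ Ideal.span (g '' S) := by
  obtain ⟨y, hy⟩ := (Submodule.mem_span_image_finset_iff_exists_fun' Λ).1 hx
  obtain ⟨c, hc, hac⟩ := hg (fun i => if i = s then x else -y i) (by
    rw [Finset.sum_insert hs, if_pos rfl]
    have : ∑ i ∈ S, (if i = s then x else -y i) * g i = -∑ i ∈ S, y i • g i := by
      rw [← Finset.sum_neg_distrib]
      refine Finset.sum_congr rfl fun i hi => ?_
      rw [if_neg (by rintro rfl; exact hs hi), smul_eq_mul, neg_mul]
    rw [this, hy]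
    ring)
  have := hac s (Finset.mem_insert_self s S)
  rw [if_pos rfl, Finset.sum_insert hs, hc.1, zero_mul, zero_add] at this
  rw [this]
  exact Ideal.sum_mem _ fun j hj =>
    Ideal.mul_mem_left _ _ (Ideal.subset_span (Set.mem_image_of_mem g hj))

end Relations

section Graded

variable {ι : Type w} {k : Type u} {Λ : Type v} [Field k] [CommRing Λ] [Algebra k Λ]
  {𝒜 : ℕ → Submodule k Λ} [GradedAlgebra 𝒜]

theorem IsAlternating.homogeneousTrunc {c : ι → ι → Λ} (hc : IsAlternating c) (D : ℕ)
    (d : ι → ℕ) : IsAlternating (fun i j => homogeneousTrunc 𝒜 (D - d i - d j) (c i j)) :=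
  ⟨fun i => by beta_reduce; rw [hc.1, homogeneousTrunc_zero],
    fun i j => by
      beta_reduce
      rw [hc.2 i j, homogeneousTrunc_neg, Nat.sub_right_comm]⟩

theorem exists_forall_mem_le_proj_eq_zero (a : ι → Λ) (S : Finset ι) :
    ∃ N, ∀ i ∈ S, ∀ n, N ≤ n → GradedRing.proj 𝒜 n (a i) = 0 := by
  choose N hN using fun i => GradedRing.exists_forall_le_proj_eq_zero (𝒜 := 𝒜) (a i)
  exact ⟨S.sup N, fun i hi n hn => hN i n ((Finset.le_sup hi).trans hn)⟩

/-- The graded Nakayama argument: one may drop a generator of positive degree. -/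
theorem OnlyTrivialRelations.of_insert [DecidableEq ι] {h : ι → Λ} {d : ι → ℕ}
    (hh : ∀ i, h i ∈ 𝒜 (d i)) {S : Finset ι} {s : ι} (hs : s ∉ S) (hd : 0 < d s)
    (hP : OnlyTrivialRelations h (insert s S)) : OnlyTrivialRelations h S := by
  suffices H : ∀ D : ℕ, ∀ a : ι → Λ,
      (∀ i ∈ S, ∀ n, D ≤ n + d i → GradedRing.proj 𝒜 n (a i) = 0) →
      ∑ i ∈ S, a i * h i = 0 →
      ∃ c : ι → ι → Λ, IsAlternating c ∧ ∀ i ∈ S, a i = ∑ j ∈ S, c i j * h j by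
    intro a ha
    obtain ⟨N, hN⟩ := exists_forall_mem_le_proj_eq_zero (𝒜 := 𝒜) a S
    refine H (N + S.sup d) a (fun i hi n hn => hN i hi n ?_) ha
    have := Finset.le_sup (f := d) hi
    omega
  intro D
  induction D using Nat.strong_induction_on with
  | _ D ih =>
  intro a hbound ha
  rcases Nat.eq_zero_or_pos D with rfl | hD
  · refine ⟨_, IsAlternating.zero, fun i hi => GradedRing.ext_proj (𝒜 := 𝒜) fun n => ?_⟩
    simp [hbound i hi n (Nat.zero_le _)]
  obtain ⟨c₀, hc₀, hac₀⟩ := hP (fun i => if i = s then 0 else a i) (by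
    rw [Finset.sum_insert hs, if_pos rfl, zero_mul, zero_add, ← ha]
    refine Finset.sum_congr rfl fun i hi => ?_
    rw [if_neg (by rintro rfl; exact hs hi)])
  set c : ι → ι → Λ := fun i j => homogeneousTrunc 𝒜 (D - d i - d j) (c₀ i j) with hcdef
  have hc : IsAlternating c := hc₀.homogeneousTrunc D d
  have hac : ∀ i ∈ insert s S, (if i = s then 0 else a i) = ∑ j ∈ insert s S, c i j * h j := by
    intro i hi
    refine GradedRing.ext_proj (𝒜 := 𝒜) fun n => ?_
    simp only [hcdef, map_sum, proj_homogeneousTrunc_mul_of_mem n _ _ (hh _)]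
    by_cases hn : n < D - d i
    · simp only [if_pos hn, ← map_sum, ← hac₀ i hi]
    · simp only [if_neg hn, Finset.sum_const_zero]
      split_ifs with his
      · exact map_zero _
      · exact hbound i ((Finset.mem_insert.1 hi).resolve_left his) n (by omega)
  obtain ⟨e, he, hbe⟩ := ih (D - d s) (by omega) (fun i => c i s) (by
      intro i _ n hn
      simp only [hcdef]
      rw [proj_homogeneousTrunc, if_neg (by omega)]) (by
      have := hac s (Finset.mem_insert_self s S)
      rw [if_pos rfl, Finset.sum_insert hs, hc.1, zero_mul, zero_add] at this
      rw [← neg_eq_zero, ← Finset.sum_neg_distrib, this]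
      refine Finset.sum_congr rfl fun i _ => ?_
      rw [hc.2 s i, neg_mul])
  refine ⟨_, hc.add (he.mul_left (h s)), fun i hi => ?_⟩
  have := hac i (Finset.mem_insert_of_mem hi)
  rw [if_neg (by rintro rfl; exact hs hi), Finset.sum_insert hs, hbe i hi] at this
  rw [this, Finset.sum_mul, ← Finset.sum_add_distrib]
  exact Finset.sum_congr rfl fun j _ => by ring

theorem OnlyTrivialRelations.mono [DecidableEq ι] {h : ι → Λ} {d : ι → ℕ}
    (hh : ∀ i, h i ∈ 𝒜 (d i)) (hd : ∀ i, 0 < d i) {S T : Finset ι} (hST : S ⊆ T)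
    (hP : OnlyTrivialRelations h T) : OnlyTrivialRelations h S := by
  obtain ⟨R, hR, rfl⟩ : ∃ R, Disjoint S R ∧ T = R ∪ S :=
    ⟨T \ S, Finset.disjoint_sdiff, (Finset.sdiff_union_of_subset hST).symm⟩
  clear hST hR
  induction R using Finset.induction_on with
  | empty => simpa using hP
  | insert s R _ ih =>
    rw [Finset.insert_union] at hP
    by_cases hs : s ∈ R ∪ S
    · rw [Finset.insert_eq_of_mem hs] at hP
      exact ih hP
    · exact ih (hP.of_insert hh hs (hd s))

/-- If the principal symbols have only trivial relations, then any combination of the `g i`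
lying in filtration degree less than `m` can be rewritten, modulo trivial relations, so that
each summand has filtration degree less than `m`. -/
theorem exists_isAlternating_proj_sub_eq_zero {g : ι → Λ} {d : ι → ℕ} {S : Finset ι}
    (hg : ∀ i, ∀ n, d i < n → GradedRing.proj 𝒜 n (g i) = 0)
    (hP : OnlyTrivialRelations (fun i => GradedRing.proj 𝒜 (d i) (g i)) S) (m : ℕ) (a : ι → Λ)
    (ha : ∀ n, m ≤ n → GradedRing.proj 𝒜 n (∑ i ∈ S, a i * g i) = 0) :
    ∃ c : ι → ι → Λ, IsAlternating c ∧ ∀ i ∈ S, ∀ n, m ≤ n + d i →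
      GradedRing.proj 𝒜 n (a i - ∑ j ∈ S, c i j * g j) = 0 := by
  obtain ⟨N, hN⟩ := exists_forall_mem_le_proj_eq_zero (𝒜 := 𝒜) a S
  have hbound : ∀ i ∈ S, ∀ n, m + (N + S.sup d) ≤ n + d i → GradedRing.proj 𝒜 n (a i) = 0 := by
    intro i hi n hn
    have := Finset.le_sup (f := d) hi
    exact hN i hi n (by omega)
  clear hN
  generalize N + S.sup d = r at hbound
  induction r generalizing a with
  | zero => exact ⟨_, IsAlternating.zero, by simpa using hbound⟩
  | succ r ih =>
  set D := m + r with hD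
  have htop : ∀ i ∈ S, GradedRing.proj 𝒜 D (a i * g i) =
      (if d i ≤ D then GradedRing.proj 𝒜 (D - d i) (a i) else 0) *
        GradedRing.proj 𝒜 (d i) (g i) := by
    intro i hi
    have := proj_homogeneousTrunc_mul (𝒜 := 𝒜) (n := D) (e := D + 1) (a i) (hg i) le_rfl
    rw [homogeneousTrunc_eq_self (fun n hn => hbound i hi n (by omega)),
      if_pos (Nat.lt_succ_self D),
      GradedRing.proj_mul_of_right_mem D _ (GradedRing.proj_mem _ _)] at this
    rw [this]
    split_ifs <;> simp
  obtain ⟨c₀, hc₀, hac₀⟩ := hP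
    (fun i => if d i ≤ D then GradedRing.proj 𝒜 (D - d i) (a i) else 0) (by
      rw [← Finset.sum_congr rfl htop, ← map_sum]
      exact ha D (by omega))
  set c : ι → ι → Λ := fun i j => homogeneousTrunc 𝒜 (D + 1 - d i - d j) (c₀ i j) with hcdef
  have hc : IsAlternating c := hc₀.homogeneousTrunc (D + 1) d
  obtain ⟨e, he, hae⟩ := ih (fun i => a i - ∑ j ∈ S, c i j * g j) (by
      simp only [sub_mul, Finset.sum_sub_distrib, hc.sum_eq_zero, sub_zero]
      exact ha) (by
      intro i hi n hn
      have hn' : D + 1 - d i ≤ n + 1 := by omega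
      simp only [hcdef, map_sub, map_sum, proj_homogeneousTrunc_mul _ (hg _) hn']
      by_cases hlt : n < D + 1 - d i
      · obtain rfl : n = D - d i := by omega
        simp only [if_pos hlt, ← map_sum, ← hac₀ i hi]
        rw [if_pos (by omega : d i ≤ D),
          GradedRing.proj_of_mem _ (GradedRing.proj_mem _ _), if_pos rfl, sub_self]
      · simp only [if_neg hlt, Finset.sum_const_zero, sub_zero]
        exact hbound i hi n (by omega))
  refine ⟨_, hc.add he, fun i hi n hn => ?_⟩
  rw [← hae i hi n hn]
  simp only [add_mul, Finset.sum_add_distrib, sub_sub]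

theorem OnlyTrivialRelations.of_principalSymbols {g : ι → Λ} {d : ι → ℕ} {S : Finset ι}
    (hg : ∀ i, ∀ n, d i < n → GradedRing.proj 𝒜 n (g i) = 0)
    (hP : OnlyTrivialRelations (fun i => GradedRing.proj 𝒜 (d i) (g i)) S) :
    OnlyTrivialRelations g S := by
  intro a ha
  obtain ⟨c, hc, hac⟩ := exists_isAlternating_proj_sub_eq_zero hg hP 0 a (by simp [ha])
  refine ⟨c, hc, fun i hi => sub_eq_zero.1 (GradedRing.ext_proj (𝒜 := 𝒜) fun n => ?_)⟩
  rw [hac i hi n (Nat.zero_le _), map_zero]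

theorem span_ne_top_of_principalSymbols [Nontrivial Λ] {g : ι → Λ} {d : ι → ℕ} {S : Finset ι}
    (hd : ∀ i, 0 < d i) (hg : ∀ i, ∀ n, d i < n → GradedRing.proj 𝒜 n (g i) = 0)
    (hP : OnlyTrivialRelations (fun i => GradedRing.proj 𝒜 (d i) (g i)) S) :
    Ideal.span (g '' S) ≠ ⊤ := by
  rw [Ideal.ne_top_iff_one]
  intro hone
  obtain ⟨a, ha⟩ := (Submodule.mem_span_image_finset_iff_exists_fun' Λ).1 hone
  simp only [smul_eq_mul] at ha
  obtain ⟨c, hc, hac⟩ := exists_isAlternating_proj_sub_eq_zero hg hP 1 a (by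
    intro n hn
    rw [ha, GradedRing.proj_of_mem n (SetLike.GradedOne.one_mem (A := 𝒜)), if_neg (by omega)])
  have hzero : ∀ i ∈ S, a i = ∑ j ∈ S, c i j * g j := by
    refine fun i hi => sub_eq_zero.1 (GradedRing.ext_proj (𝒜 := 𝒜) fun n => ?_)
    rw [hac i hi n (by have := hd i; omega), map_zero]
  refine one_ne_zero (α := Λ) ?_
  rw [← ha, Finset.sum_congr rfl fun i hi => by rw [hzero i hi], hc.sum_eq_zero]

end Graded

section Koszul

variable {k : Type u} {U : Type v} [CommRing k] [CommRing U] [Algebra k U] {t : ℕ}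

theorem koszulD_single (g : Fin t → U) (i : ℕ) (s : {s : Finset (Fin t) // s.card = i + 1})
    (u : U) : koszulD k g i (Finsupp.single s u) =
      ∑ j ∈ s.1.attach, Finsupp.single
        (⟨s.1.erase j.1, by simp [Finset.card_erase_of_mem j.2, s.2]⟩ :
            {s : Finset (Fin t) // s.card = i})
        (u * ((-1 : U) ^ (s.1.filter fun a => a < j.1).card * g j.1)) := by
  rw [koszulD, Finsupp.lsum_single, LinearMap.sum_apply]
  rfl

theorem koszulD_one_apply_singleton (g : Fin t → U)
    (w : {s : Finset (Fin t) // s.card = 2} →₀ U) :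
    ∃ c : Fin t → Fin t → U, IsAlternating c ∧
      ∀ i, koszulD k g 1 w ⟨{i}, Finset.card_singleton i⟩ = ∑ j, c i j * g j := by
  induction w using Finsupp.induction_linear with
  | zero => exact ⟨_, IsAlternating.zero, by simp⟩
  | add w₁ w₂ h₁ h₂ =>
    obtain ⟨c, hc, hw₁⟩ := h₁
    obtain ⟨e, he, hw₂⟩ := h₂
    refine ⟨_, hc.add he, fun i => ?_⟩
    rw [map_add, Finsupp.add_apply, hw₁, hw₂]
    simp only [add_mul, Finset.sum_add_distrib]
  | single s u =>
    refine ⟨fun i j => if i ≠ j ∧ s.1 = {i, j} then (if i < j then -u else u) else 0,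
      ⟨by simp, fun i j => ?_⟩, fun i => ?_⟩
    · beta_reduce
      rw [Finset.pair_comm j i]
      rcases lt_trichotomy i j with h | h | h
      · simp only [h, h.ne, h.ne', h.not_gt, ne_eq, not_false_eq_true, true_and, if_true, if_false]
        split_ifs <;> simp
      · simp [h]
      · simp only [h, h.ne, h.ne', h.not_gt, ne_eq, not_false_eq_true, true_and, if_true, if_false]
        split_ifs <;> simp
    · rw [koszulD_single, Finsupp.finsetSum_apply]
      simp only [Finsupp.single_apply, Subtype.mk.injEq]
      rw [Finset.sum_attach s.1 (fun j => if s.1.erase j = {i} then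
        u * ((-1 : U) ^ (s.1.filter fun a => a < j).card * g j) else 0),
        ← Finset.sum_subset (Finset.subset_univ s.1)]
      · refine Finset.sum_congr rfl fun j hj => ?_
        have hiff : s.1.erase j = {i} ↔ i ≠ j ∧ s.1 = {i, j} := by
          constructor
          · intro h
            have hi : i ∈ s.1.erase j := by rw [h]; exact Finset.mem_singleton_self i
            refine ⟨Finset.ne_of_mem_erase hi, ?_⟩
            rw [← Finset.insert_erase hj, h, Finset.pair_comm]
          · rintro ⟨hij, h⟩
            rw [h, Finset.pair_comm, Finset.erase_insert]
            simpa using hij.symm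
        by_cases h : s.1.erase j = {i}
        · rw [if_pos h, if_pos (hiff.1 h), (hiff.1 h).2, Finset.filter_insert,
            Finset.filter_singleton]
          simp only [lt_irrefl, if_false]
          split_ifs <;> simp
        · rw [if_neg h, if_neg (mt hiff.2 h), zero_mul]
      · intro j _ hj
        rw [if_neg, zero_mul]
        rintro ⟨-, h⟩
        exact hj (by rw [h]; simp)

theorem IsCompleteIntersection.onlyTrivialRelations {h : Fin t → U}
    (hCI : IsCompleteIntersection k h) : OnlyTrivialRelations h Finset.univ := by
  intro a ha
  set z : {s : Finset (Fin t) // s.card = 1} →₀ U :=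
    ∑ i, Finsupp.single ⟨{i}, Finset.card_singleton i⟩ (a i) with hz
  have hker : z ∈ LinearMap.ker (koszulD k h 0) := by
    rw [LinearMap.mem_ker, hz, map_sum]
    simp only [koszulD_single]
    have hsum : ∀ i : Fin t, ∑ j ∈ ({i} : Finset (Fin t)).attach, Finsupp.single
        (⟨({i} : Finset (Fin t)).erase j.1, by simp [Finset.card_erase_of_mem j.2]⟩ :
            {s : Finset (Fin t) // s.card = 0})
        (a i * ((-1 : U) ^ (({i} : Finset (Fin t)).filter fun a => a < j.1).card * h j.1)) =
        Finsupp.single ⟨∅, Finset.card_empty⟩ (a i * h i) := by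
      intro i
      rw [Finset.sum_eq_single_of_mem ⟨i, Finset.mem_singleton_self i⟩ (Finset.mem_attach _ _)]
      · simp [Finset.filter_singleton]
      · rintro ⟨j, hj⟩ - hne
        exact absurd (Subtype.ext (Finset.mem_singleton.1 hj)) hne
    rw [Finset.sum_congr rfl fun i _ => hsum i, ← Finsupp.single_finsetSum, ha,
      Finsupp.single_zero]
  rw [hCI.1 0] at hker
  obtain ⟨w, hw⟩ := hker
  obtain ⟨c, hc, hcw⟩ := koszulD_one_apply_singleton (k := k) h w
  refine ⟨c, hc, fun i _ => ?_⟩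
  rw [← hcw, hw, hz, Finsupp.finsetSum_apply]
  simp [Finsupp.single_apply]

end Koszul

/-- Let `Λ` be a graded affine `k`-algebra with its associated filtration,
and let `g = {g 1, …, g t} ⊆ Λ` be a sequence whose principal symbols (top-degree
homogeneous components) `ḡ 1, …, ḡ t` form a complete intersection for `Λ`. Then `g` is a
regular sequence in `Λ`. Here `d i` is the degree of `g i` and its principal symbol is its
degree-`d i` homogeneous component. -/
theorem statement5 {k : Type u} {Λ : Type v} [Field k] [IsAlgClosed k] [CharZero k]
    [CommRing Λ] [Nontrivial Λ] [Algebra k Λ] [Algebra.FiniteType k Λ]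
    (𝒜 : ℕ → Submodule k Λ) [GradedAlgebra 𝒜] (h0 : 𝒜 0 = 1)
    {t : ℕ} (g : Fin t → Λ) (d : Fin t → ℕ)
    (hdeg : ∀ i, ∀ j, d i < j → ((DirectSum.decompose 𝒜 (g i) j : 𝒜 j) : Λ) = 0)
    (hne : ∀ i, ((DirectSum.decompose 𝒜 (g i) (d i) : 𝒜 (d i)) : Λ) ≠ 0)
    (hCI : IsCompleteIntersection k
      (fun i => ((DirectSum.decompose 𝒜 (g i) (d i) : 𝒜 (d i)) : Λ))) :
    IsRegularSequence g := by
  have hd : ∀ i, 0 < d i := by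
    intro i
    rw [Nat.pos_iff_ne_zero]
    intro hi
    refine hCI.2 (Ideal.eq_top_of_isUnit_mem _ (Ideal.subset_span (Set.mem_range_self i)) ?_)
    have hmem := (DirectSum.decompose 𝒜 (g i) (d i)).2
    have hmem0 : ((DirectSum.decompose 𝒜 (g i) (d i) : 𝒜 (d i)) : Λ) ∈ (1 : Submodule k Λ) := by
      rw [← h0, ← hi]
      exact hmem
    obtain ⟨r, hr⟩ := Submodule.mem_one.1 hmem0
    have hr0 : r ≠ 0 := by
      rintro rfl
      exact hne i (by rw [← hr, map_zero])
    simp only [← hr]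
    exact (IsUnit.mk0 r hr0).map (algebraMap k Λ)
  have hP : ∀ S : Finset (Fin t),
      OnlyTrivialRelations (fun i => GradedRing.proj 𝒜 (d i) (g i)) S := fun S =>
    OnlyTrivialRelations.mono (fun i => GradedRing.proj_mem (d i) (g i)) hd (Finset.subset_univ S)
      hCI.onlyTrivialRelations
  intro i
  have hlt : {j | j < i} = ((Finset.Iio i : Finset (Fin t)) : Set (Fin t)) := by ext; simp
  have hle : {j | j ≤ i} = ((Finset.Iic i : Finset (Fin t)) : Set (Fin t)) := by ext; simp
  rw [hlt, hle]
  exact ⟨fun x => (OnlyTrivialRelations.of_principalSymbols hdeg (hP _)).mem_span (by simp),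
    span_ne_top_of_principalSymbols hd hdeg (hP _)⟩

end
end

section
/- Let U be a filtered k-algebra such that the associated graded algebra gr U is a commutative affine Cohen–Macaulay k-algebra. If g_1,…,g_t are mutually commuting elements of U such that V(ḡ_1,…,ḡ_t) ⊆ Sp(gr U) is equidimensional of codimension t, then every character μ ∈ Sp k[g_1,…,g_t] lifts to a simple left U-module, i.e. there is a simple left U-module M generated by m ∈ M with g_i·m = μ(g_i)m for all i. -/
open scoped TensorProduct

noncomputable section

universe u v w

/-- The Zariski topology on the "maximal spectrum" `Sp Λ` of an affine algebra over an
algebraically closed field, modelled by the set of `k`-characters of `Λ`: a basis of open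
sets is given by the sets `{χ | χ f ≠ 0}`. -/
instance spTopology (k : Type u) (R : Type v) [CommSemiring k] [Semiring R] [Algebra k R] :
    TopologicalSpace (R →ₐ[k] k) :=
  TopologicalSpace.generateFrom {s | ∃ f : R, s = {χ : R →ₐ[k] k | χ f ≠ 0}}

/-- The zero set `V(S) ⊆ Sp Λ` of a set of elements of `Λ`. -/
def spZeroLocus (k : Type u) {R : Type v} [CommSemiring k] [Semiring R] [Algebra k R]
    (S : Set R) : Set (R →ₐ[k] k) :=
  {χ | ∀ f ∈ S, χ f = 0}

/-- The dimension of a subset of a topological space. -/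
noncomputable def setDim {X : Type u} [TopologicalSpace X] (S : Set X) : WithBot ℕ∞ :=
  topologicalKrullDim S

/-- A subset of a topological space is equidimensional of dimension `d` if it is nonempty
and all its irreducible components have dimension `d`. -/
def EquidimOfDim {X : Type u} [TopologicalSpace X] (S : Set X) (d : ℕ) : Prop :=
  S.Nonempty ∧ ∀ C ∈ irreducibleComponents S, topologicalKrullDim C = (d : WithBot ℕ∞)

/-- The Cohen-Macaulay property as used in the paper: for every proper ideal `I`,
the depth of `I` (maximal length of a regular sequence contained in `I`) equals the
codimension of `I` (the minimal codimension in `Sp Λ` of an irreducible component of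
`V(I)`, i.e. `dim Sp Λ - dim V(I)`). -/
def IsPaperCM (k : Type u) (Λ : Type v) [Field k] [CommRing Λ] [Algebra k Λ] : Prop :=
  ∀ I : Ideal Λ, I ≠ ⊤ → ∃ c : ℕ,
    (setDim (spZeroLocus k (I : Set Λ)) + (c : WithBot ℕ∞) =
      topologicalKrullDim (Λ →ₐ[k] k)) ∧
    (∃ g : Fin c → Λ, (∀ i, g i ∈ I) ∧ IsRegularSequence g) ∧
    (∀ (m : ℕ) (g : Fin m → Λ), (∀ i, g i ∈ I) → IsRegularSequence g → m ≤ c)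

/-- A subset of a topological space is equidimensional of codimension `c` if it is nonempty
and all its irreducible components have codimension `c`, i.e. dimension `dim X − c`. -/
def EquidimOfCodim {X : Type u} [TopologicalSpace X] (S : Set X) (c : ℕ) : Prop :=
  S.Nonempty ∧ ∀ C ∈ irreducibleComponents S,
    topologicalKrullDim C + (c : WithBot ℕ∞) = topologicalKrullDim X

section Koszul

open AlternatingMap

variable {R : Type*} {E M M' : Type*} [CommRing R] [AddCommGroup E] [Module R E]
  [AddCommGroup M] [Module R M] [AddCommGroup M'] [Module R M']

/-- Exactness of the Koszul complex of `M` in degree `n + 1`, where `n`-chains are alternating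
`n`-forms on `E` with values in `M` and the differential is the contraction with `v : E`. -/
def KoszulExactAt (v : E) (M : Type*) [AddCommGroup M] [Module R M] (n : ℕ) : Prop :=
  ∀ z : E [⋀^Fin (n + 1)]→ₗ[R] M, z.curryLeft v = 0 →
    ∃ w : E [⋀^Fin (n + 2)]→ₗ[R] M, w.curryLeft v = z

/-- Alternating forms on a free module lift along surjections. -/
theorem AlternatingMap.exists_compAlternatingMap_eq [Module.Free R E] (φ : M →ₗ[R] M')
    (hφ : Function.Surjective φ) {n : ℕ} (w : E [⋀^Fin n]→ₗ[R] M') :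
    ∃ w' : E [⋀^Fin n]→ₗ[R] M, φ.compAlternatingMap w' = w := by
  obtain ⟨W, hW⟩ := Module.projective_lifting_property φ
    (exteriorPower.alternatingMapLinearEquiv w) hφ
  refine ⟨exteriorPower.alternatingMapLinearEquiv.symm W,
    exteriorPower.alternatingMapLinearEquiv.injective ?_⟩
  rw [exteriorPower.alternatingMapLinearEquiv_comp, LinearEquiv.apply_symm_apply, hW]

/-- An alternating form with values in `x • M` is divisible by the nonzerodivisor `x`. -/
theorem AlternatingMap.exists_eq_smul {x : R} (hx : Function.Injective fun m : M => x • m) {n : ℕ}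
    (w : E [⋀^Fin n]→ₗ[R] M) (hw : ∀ a, ∃ m, w a = x • m) :
    ∃ y : E [⋀^Fin n]→ₗ[R] M, w = x • y := by
  choose y hy using hw
  refine ⟨{ toFun := y, map_update_add' := ?_, map_update_smul' := ?_, map_eq_zero_of_eq' := ?_ },
    AlternatingMap.ext fun a => hy a⟩
  · intro _ m i a b
    apply hx
    simp only [smul_add, ← hy]
    convert w.map_update_add m i a b
  · intro _ m i c a
    apply hx
    simp only [smul_comm x c, ← hy]
    convert w.map_update_smul m i c a
  · intro a i j h hij
    apply hx
    simp only [← hy, smul_zero]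
    exact w.map_eq_zero_of_eq a h hij

/-- Exterior multiplication by the linear form `e` is a null-homotopy for multiplication
by `e v` on cycles. -/
theorem AlternatingMap.exists_curryLeft_eq_smul (v : E) (e : E →ₗ[R] R) {n : ℕ}
    (z : E [⋀^Fin (n + 1)]→ₗ[R] M) (hz : z.curryLeft v = 0) :
    ∃ w : E [⋀^Fin (n + 2)]→ₗ[R] M, w.curryLeft v = e v • z := by
  refine ⟨alternatizeUncurryFin (e.smulRight z), ?_⟩
  ext a
  have hz' : ∀ b : Fin n → E, z (Matrix.vecCons v b) = 0 := fun b => by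
    rw [← curryLeft_apply_apply, hz, AlternatingMap.zero_apply]
  rw [curryLeft_apply_apply, alternatizeUncurryFin_apply, Fin.sum_univ_succ]
  rw [Finset.sum_eq_zero]
  · simp [Fin.removeNth_zero, Matrix.vecCons]
  · intro i _
    have : i.succ.removeNth (Matrix.vecCons v a) = Matrix.vecCons v (i.removeNth a) := by
      ext j
      refine Fin.cases ?_ (fun j => ?_) j <;> simp [Fin.removeNth, Matrix.vecCons]
    simp [this, hz']

theorem KoszulExactAt.of_surjective [Module.Free R E] {v : E} (e : E →ₗ[R] R)
    (hx : Function.Injective fun m : M => e v • m) (φ : M →ₗ[R] M')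
    (hφ : Function.Surjective φ) (hker : ∀ m, φ m = 0 ↔ ∃ y, m = e v • y) {n : ℕ}
    (h : KoszulExactAt (R := R) v M' (n + 1)) : KoszulExactAt (R := R) v M n := by
  intro z hz
  obtain ⟨w, hw⟩ := exists_curryLeft_eq_smul v e z hz
  obtain ⟨u', hu'⟩ := h (φ.compAlternatingMap w) (by
    rw [curryLeft_compAlternatingMap, hw]
    ext a
    exact (hker _).2 ⟨_, rfl⟩)
  obtain ⟨u, rfl⟩ := exists_compAlternatingMap_eq φ hφ u'
  obtain ⟨y, hy⟩ := exists_eq_smul hx (w - u.curryLeft v) fun a => by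
    rw [← hker, AlternatingMap.sub_apply, map_sub, ← LinearMap.compAlternatingMap_apply, ← hu',
      curryLeft_compAlternatingMap, LinearMap.compAlternatingMap_apply, sub_self]
  refine ⟨y, AlternatingMap.ext fun a => hx ?_⟩
  have h1 := congrArg (fun q => curryLeft q v a) hy
  have h2 : (w - u.curryLeft v).curryLeft v a = w.curryLeft v a - (u.curryLeft v).curryLeft v a :=
    rfl
  have h3 : (e v • y).curryLeft v a = e v • y.curryLeft v a := rfl
  simp only [h2, h3, hw, curryLeft_same] at h1
  simpa using h1.symm

theorem AlternatingMap.eq_zero_of_card_lt {t n : ℕ} (h : t < n)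
    (z : (Fin t → R) [⋀^Fin n]→ₗ[R] M) : z = 0 :=
  (Pi.basisFun R (Fin t)).ext_alternating fun i hi => by
    have := Fintype.card_le_of_injective i hi
    simp at this
    omega

/-- Depth sensitivity of the Koszul complex: if the ideal generated by `f 0, …, f (t - 1)`
contains a regular sequence of length at least `t`, then the Koszul complex of `f` is exact in
positive degrees. -/
theorem koszulExactAt_of_isRegularSequence {Λ : Type u} [CommRing Λ] {t c : ℕ} (f : Fin t → Λ)
    (x : Fin c → Λ) (hx : IsRegularSequence x) (hxf : ∀ i, x i ∈ Ideal.span (Set.range f))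
    (m : ℕ) (hm : m ≤ c) (n : ℕ) (hn : t ≤ n + m) :
    KoszulExactAt (R := Λ) f
      (Λ ⧸ Ideal.span (x '' {j | (j : ℕ) < c - m})) n := by
  induction m generalizing n with
  | zero =>
    intro z _
    exact ⟨0, by rw [AlternatingMap.eq_zero_of_card_lt (by omega) z]; rfl⟩
  | succ m ih =>
    have hlt : c - (m + 1) < c := by omega
    set i : Fin c := ⟨c - (m + 1), hlt⟩
    obtain ⟨a, ha⟩ := Ideal.mem_span_range_iff_exists_fun.1 (hxf i)
    let e : (Fin t → Λ) →ₗ[Λ] Λ := ∑ j, a j • LinearMap.proj j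
    have he : e f = x i := by simp [e, ← ha]
    have hle : Ideal.span (x '' {j | (j : ℕ) < c - (m + 1)}) ≤
        Ideal.span (x '' {j | (j : ℕ) < c - m}) :=
      Ideal.span_mono (Set.image_mono fun j (hj : (j : ℕ) < _) => show (j : ℕ) < _ by omega)
    have hset : {j : Fin c | (j : ℕ) < c - m} = insert i {j : Fin c | (j : ℕ) < c - (m + 1)} := by
      ext j
      simp only [Set.mem_insert_iff, Set.mem_ofPred_eq, i, Fin.ext_iff]
      omega
    refine KoszulExactAt.of_surjective e ?_ (Submodule.factor hle)
      (Submodule.factor_surjective hle) ?_ (ih (by omega) (n + 1) (by omega))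
    · rw [he]
      refine (injective_iff_map_eq_zero (LinearMap.lsmul Λ _ (x i))).2 ?_
      intro q hq
      obtain ⟨q, rfl⟩ := Submodule.Quotient.mk_surjective _ q
      rw [LinearMap.lsmul_apply, ← Submodule.Quotient.mk_smul, Submodule.Quotient.mk_eq_zero] at hq
      exact (Submodule.Quotient.mk_eq_zero _).2 ((hx i).1 q hq)
    · intro q
      obtain ⟨q, rfl⟩ := Submodule.Quotient.mk_surjective _ q
      rw [he, show Submodule.factor hle (Submodule.Quotient.mk q) = Submodule.Quotient.mk q from rfl,
        Submodule.Quotient.mk_eq_zero, hset, Set.image_insert_eq, Ideal.mem_span_insert]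
      constructor
      · rintro ⟨y, s, hs, rfl⟩
        refine ⟨Submodule.Quotient.mk y, ?_⟩
        rw [← Submodule.Quotient.mk_smul, Submodule.Quotient.eq]
        simpa [mul_comm] using hs
      · rintro ⟨y, hy⟩
        obtain ⟨y, rfl⟩ := Submodule.Quotient.mk_surjective _ y
        rw [← Submodule.Quotient.mk_smul, Submodule.Quotient.eq] at hy
        exact ⟨y, _, hy, by simp [mul_comm]⟩

/-- If the ideal generated by `f 0, …, f (t - 1)` contains a regular sequence of length at
least `t`, then all syzygies between the `f i` are Koszul. -/
theorem exists_alternating_of_sum_mul_eq_zero {Λ : Type u} [CommRing Λ] {t c : ℕ} (f : Fin t → Λ)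
    (x : Fin c → Λ) (hx : IsRegularSequence x) (hxf : ∀ i, x i ∈ Ideal.span (Set.range f))
    (hc : t ≤ c) (a : Fin t → Λ) (ha : ∑ i, a i * f i = 0) :
    ∃ b : Fin t → Fin t → Λ, (∀ i, b i i = 0) ∧ (∀ i j, b i j = - b j i) ∧
      ∀ i, a i = ∑ j, b i j * f j := by
  have hex := koszulExactAt_of_isRegularSequence f x hx hxf c le_rfl 0 (by omega)
  have hbot : Ideal.span (x '' {j | (j : ℕ) < c - c}) = ⊥ := by simp
  rw [hbot] at hex
  let q : Λ →ₗ[Λ] Λ ⧸ (⊥ : Ideal Λ) := Submodule.mkQ ⊥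
  let l : (Fin t → Λ) →ₗ[Λ] Λ := ∑ j, a j • LinearMap.proj j
  have hl : l f = 0 := by simp [l, ha]
  let z : (Fin t → Λ) [⋀^Fin 1]→ₗ[Λ] (Λ ⧸ (⊥ : Ideal Λ)) :=
    AlternatingMap.ofSubsingleton Λ (Fin t → Λ) _ (0 : Fin 1) (q ∘ₗ l)
  obtain ⟨w, hw⟩ := hex z (by
    ext s
    simp [z, hl])
  let p : Λ ⧸ (⊥ : Ideal Λ) →ₗ[Λ] Λ := Submodule.liftQ ⊥ LinearMap.id (by simp)
  have hp : ∀ y, p (q y) = y := fun y => rfl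
  let b : Fin t → Fin t → Λ := fun i j => p (w ![Pi.single j 1, Pi.single i 1])
  refine ⟨b, fun i => ?_, fun i j => ?_, fun i => ?_⟩
  · simp only [b]
    rw [w.map_eq_zero_of_eq _ (i := 0) (j := 1) (by simp) (by simp), LinearMap.map_zero]
  · simp only [b]
    rw [← map_neg, ← w.map_swap _ (i := 0) (j := 1) (by simp)]
    congr 2
    ext s : 1
    fin_cases s <;> simp
  · have h1 := congrArg (fun y => p (y ![Pi.single i 1])) hw
    have h2 : p (z ![Pi.single i 1]) = a i := by simp [z, hp, l, Pi.single_apply]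
    simp only [h2, curryLeft_apply_apply] at h1
    rw [← h1]
    let L : (Fin t → Λ) →ₗ[Λ] Λ ⧸ (⊥ : Ideal Λ) :=
      { toFun := fun y => w.curryLeft y ![Pi.single i 1]
        map_add' := fun y y' => by rw [map_add, AlternatingMap.add_apply]
        map_smul' := fun r y => by rw [LinearMap.map_smul]; rfl }
    have h3 : w ![f, Pi.single i 1] = ∑ j, f j • w ![Pi.single j 1, Pi.single i 1] := by
      change L f = ∑ j, f j • L (Pi.single j 1)
      conv_lhs => rw [pi_eq_sum_univ' f]
      simp only [map_sum, LinearMap.map_smul]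
    rw [h3, map_sum]
    simp [b, mul_comm]

end Koszul

section Dimension

/-- The map sending a character to its kernel is inducing. -/
theorem spTopology_isInducing (k : Type u) (R : Type v) [Field k] [CommRing R] [Algebra k R] :
    Topology.IsInducing fun χ : R →ₐ[k] k =>
      (⟨RingHom.ker χ, RingHom.ker_isPrime χ⟩ : PrimeSpectrum R) := by
  constructor
  rw [PrimeSpectrum.isTopologicalBasis_basic_opens.eq_generateFrom, induced_generateFrom_eq]
  refine congrArg TopologicalSpace.generateFrom (Set.ext fun s => ?_)
  constructor
  · rintro ⟨f, rfl⟩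
    exact ⟨_, ⟨f, rfl⟩, by ext χ; simp [RingHom.mem_ker]⟩
  · rintro ⟨_, ⟨f, rfl⟩, rfl⟩
    exact ⟨f, by ext χ; simp [RingHom.mem_ker]⟩

theorem topologicalKrullDim_characters_lt_top (k : Type u) (R : Type v) [Field k] [CommRing R]
    [Algebra k R] [Algebra.FiniteType k R] : topologicalKrullDim (R →ₐ[k] k) < ⊤ := by
  refine (spTopology_isInducing k R).topologicalKrullDim_le.trans_lt ?_
  rw [PrimeSpectrum.topologicalKrullDim_eq_ringKrullDim]
  obtain ⟨n, f, hf⟩ := Algebra.FiniteType.iff_quotient_mvPolynomial''.1 ‹Algebra.FiniteType k R›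
  refine (ringKrullDim_le_of_surjective f.toRingHom hf).trans_lt ?_
  rw [MvPolynomial.ringKrullDim_of_isNoetherianRing, ringKrullDim_eq_zero_of_field, zero_add]
  exact WithBot.coe_lt_coe.2 (WithTop.coe_lt_top _)

theorem Topology.IsInducing.isIrreducible_of_image {X Y : Type*} [TopologicalSpace X]
    [TopologicalSpace Y] {f : X → Y} (hf : Topology.IsInducing f) {s : Set X}
    (hs : IsIrreducible (f '' s)) : IsIrreducible s := by
  refine ⟨hs.1.of_image, fun u v hu hv ⟨a, ha, hau⟩ ⟨b, hb, hbv⟩ => ?_⟩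
  obtain ⟨u, hu', rfl⟩ := hf.isOpen_iff.1 hu
  obtain ⟨v, hv', rfl⟩ := hf.isOpen_iff.1 hv
  obtain ⟨_, ⟨x, hx, rfl⟩, hxuv⟩ := hs.2 u v hu' hv' ⟨_, ⟨a, ha, rfl⟩, hau⟩ ⟨_, ⟨b, hb, rfl⟩, hbv⟩
  exact ⟨x, hx, hxuv⟩

/-- The length of a chain of irreducible closed subsets is bounded by the dimension of an
irreducible component. -/
theorem exists_irreducibleComponents_length_le {X : Type*} [TopologicalSpace X]
    (p : LTSeries (TopologicalSpace.IrreducibleCloseds X)) :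
    ∃ C ∈ irreducibleComponents X, (p.length : WithBot ℕ∞) ≤ topologicalKrullDim C := by
  obtain ⟨C, hC, hpC⟩ := exists_mem_irreducibleComponents_subset_of_isIrreducible
    (p.last : Set X) p.last.isIrreducible
  refine ⟨C, hC, ?_⟩
  have hsub : ∀ i, (p i : Set X) ⊆ C := fun i =>
    (show (p i : Set X) ⊆ p.last from p.strictMono.monotone (Fin.le_last i)).trans hpC
  have himg : ∀ i, (Subtype.val '' ((Subtype.val ⁻¹' (p i : Set X)) : Set C)) = p i := fun i => by
    rw [Subtype.image_preimage_coe, Set.inter_eq_right.2 (hsub i)]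
  let q : LTSeries (TopologicalSpace.IrreducibleCloseds C) :=
    { length := p.length
      toFun := fun i => ⟨Subtype.val ⁻¹' (p i : Set X),
        Topology.IsInducing.subtypeVal.isIrreducible_of_image
          (by rw [himg]; exact (p i).isIrreducible), (p i).isClosed.preimage continuous_subtype_val⟩
      step := fun i => by
        have hss : (Subtype.val ⁻¹' (p i.castSucc : Set X) : Set C) ⊂
            Subtype.val ⁻¹' (p i.succ : Set X) := by
          rw [← Subtype.val_injective.injOn.image_ssubset_image_iff (Set.subset_univ _)
            (Set.subset_univ _), himg, himg]
          exact p.step i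
        exact hss }
  exact Order.LTSeries.length_le_krullDim q

theorem le_of_equidimOfCodim {X : Type*} [TopologicalSpace X] (hX : topologicalKrullDim X < ⊤)
    {S : Set X} {t c : ℕ} (hS : EquidimOfCodim S t)
    (hc : setDim S + (c : WithBot ℕ∞) = topologicalKrullDim X) : t ≤ c := by
  obtain ⟨⟨s, hs⟩, hS⟩ := hS
  have : Nonempty (TopologicalSpace.IrreducibleCloseds S) :=
    ⟨⟨closure {⟨s, hs⟩}, isIrreducible_singleton.closure, isClosed_closure⟩⟩
  obtain ⟨n, hn⟩ : ∃ n : ℕ, setDim S = n := by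
    have h1 : setDim S < ⊤ := (topologicalKrullDim_subspace_le X S).trans_lt hX
    have h2 : setDim S ≠ ⊥ := Order.krullDim_ne_bot_iff.2 this
    obtain ⟨e, he⟩ := WithBot.ne_bot_iff_exists.1 h2
    rw [← he] at h1 ⊢
    obtain ⟨n, hn⟩ := ENat.ne_top_iff_exists.1 (WithBot.coe_lt_coe.1 h1).ne
    exact ⟨n, by rw [← hn]; rfl⟩
  obtain ⟨p, hp⟩ : ∃ p : LTSeries (TopologicalSpace.IrreducibleCloseds S), p.length = n :=
    Order.le_krullDim_iff.1 (show (n : WithBot ℕ∞) ≤ _ from hn.ge)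
  obtain ⟨C, hC, hpC⟩ := exists_irreducibleComponents_length_le p
  have h := hS C hC
  rw [← hc, hn] at h
  have : (n : WithBot ℕ∞) + t ≤ n + c := by
    rw [← h, ← hp]
    gcongr
  have : n + t ≤ n + c := by exact_mod_cast this
  omega

end Dimension

section Filtered

variable {k : Type u} {U : Type v} {B : Type w} [Field k] [Ring U] [Algebra k U] [CommRing B]
  [Algebra k B]

open Classical in
/-- The symbol of degree `n` of an element of `F n`, extended by zero to `U`. -/
def symbolAt (F : ℕ → Submodule k U) (π : ∀ i : ℕ, F i →ₗ[k] B) (n : ℕ) (u : U) : B :=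
  if h : u ∈ F n then π n ⟨u, h⟩ else 0

/-- The filtration `F` shifted by `e`: the piece `F (n - e)`, which is zero if `n < e`. -/
def shiftedFiltration (F : ℕ → Submodule k U) (e n : ℕ) : Submodule k U :=
  if e ≤ n then F (n - e) else ⊥

variable {F : ℕ → Submodule k U} {ℬ : ℕ → Submodule k B} {π : ∀ i : ℕ, F i →ₗ[k] B}

theorem symbolAt_of_mem {n : ℕ} {u : U} (h : u ∈ F n) : symbolAt F π n u = π n ⟨u, h⟩ :=
  dif_pos h

@[simp]
theorem symbolAt_zero (n : ℕ) : symbolAt F π n 0 = 0 := by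
  rw [symbolAt_of_mem (zero_mem _)]
  exact map_zero (π n)

theorem symbolAt_sub {n : ℕ} {u v : U} (hu : u ∈ F n) (hv : v ∈ F n) :
    symbolAt F π n (u - v) = symbolAt F π n u - symbolAt F π n v := by
  rw [symbolAt_of_mem hu, symbolAt_of_mem hv, symbolAt_of_mem (sub_mem hu hv), ← map_sub]
  rfl

theorem symbolAt_neg {n : ℕ} {u : U} (hu : u ∈ F n) :
    symbolAt F π n (-u) = -symbolAt F π n u := by
  simpa using symbolAt_sub (π := π) (zero_mem (F n)) hu

theorem symbolAt_sum {ι : Type*} {n : ℕ} (s : Finset ι) {u : ι → U} (hu : ∀ i ∈ s, u i ∈ F n) :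
    symbolAt F π n (∑ i ∈ s, u i) = ∑ i ∈ s, symbolAt F π n (u i) := by
  classical
  induction s using Finset.induction_on with
  | empty => simp
  | insert i s hi ih =>
    have hs : ∀ j ∈ s, u j ∈ F n := fun j hj => hu j (Finset.mem_insert_of_mem hj)
    rw [Finset.sum_insert hi, Finset.sum_insert hi, ← ih hs, ← sub_neg_eq_add,
      symbolAt_sub (hu i (Finset.mem_insert_self i s)) (neg_mem (sum_mem hs)),
      symbolAt_neg (sum_mem hs), sub_neg_eq_add]

theorem IsAlgebraFiltration.mul_mem
    (hF : IsAlgebraFiltration F) {m n : ℕ} {u v : U} (hu : u ∈ F m) (hv : v ∈ F n) :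
    u * v ∈ F (m + n) :=
  hF.mul_le m n (Submodule.mul_mem_mul hu hv)

theorem IsAssociatedGraded.symbolAt_mul
    (hF : IsAlgebraFiltration F) (hπ : IsAssociatedGraded F ℬ π) {m n : ℕ} {u v : U}
    (hu : u ∈ F m) (hv : v ∈ F n) :
    symbolAt F π (m + n) (u * v) = symbolAt F π m u * symbolAt F π n v := by
  rw [symbolAt_of_mem hu, symbolAt_of_mem hv, symbolAt_of_mem (hF.mul_mem hu hv), ← hπ.map_mul]

theorem IsAssociatedGraded.symbolAt_succ_eq_zero_iff
    (hπ : IsAssociatedGraded F ℬ π) {n : ℕ} {u : U} (hu : u ∈ F (n + 1)) :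
    symbolAt F π (n + 1) u = 0 ↔ u ∈ F n := by
  rw [symbolAt_of_mem hu, hπ.ker_succ]

theorem IsAssociatedGraded.eq_zero_of_symbolAt_zero
    (hπ : IsAssociatedGraded F ℬ π) {u : U} (hu : u ∈ F 0)
    (h : symbolAt F π 0 u = 0) : u = 0 := by
  rw [symbolAt_of_mem hu] at h
  exact congrArg Subtype.val (hπ.injective_zero (h.trans (map_zero (π 0)).symm))

theorem IsAssociatedGraded.symbolAt_mem
    (hπ : IsAssociatedGraded F ℬ π) (n : ℕ) (u : U) : symbolAt F π n u ∈ ℬ n := by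
  by_cases h : u ∈ F n
  · rw [symbolAt_of_mem h, ← hπ.range_eq]
    exact ⟨_, rfl⟩
  · rw [symbolAt, dif_neg h]
    exact zero_mem _

theorem IsAssociatedGraded.exists_symbolAt_eq
    (hπ : IsAssociatedGraded F ℬ π) {n : ℕ} {b : B} (hb : b ∈ ℬ n) :
    ∃ u ∈ F n, symbolAt F π n u = b := by
  rw [← hπ.range_eq] at hb
  obtain ⟨u, rfl⟩ := hb
  exact ⟨u, u.2, symbolAt_of_mem u.2⟩

theorem mem_shiftedFiltration_of_le {e n : ℕ} (h : e ≤ n) {u : U} :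
    u ∈ shiftedFiltration F e n ↔ u ∈ F (n - e) := by
  rw [shiftedFiltration, if_pos h]

theorem mem_shiftedFiltration_of_lt {e n : ℕ} (h : n < e) {u : U} :
    u ∈ shiftedFiltration F e n ↔ u = 0 := by
  rw [shiftedFiltration, if_neg h.not_ge, Submodule.mem_bot]

/-- Products with an element of `F e'` lower the shift of the filtration by `e'`. -/
theorem IsAlgebraFiltration.mul_mem_shiftedFiltration
    (hF : IsAlgebraFiltration F) {e e' n : ℕ} {u v : U}
    (hu : u ∈ shiftedFiltration F (e + e') n) (hv : v ∈ F e') :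
    u * v ∈ shiftedFiltration F e n := by
  rcases le_or_gt (e + e') n with h | h
  · rw [mem_shiftedFiltration_of_le h] at hu
    rw [mem_shiftedFiltration_of_le (by omega), show n - e = n - (e + e') + e' by omega]
    exact hF.mul_mem hu hv
  · rw [mem_shiftedFiltration_of_lt h] at hu
    simp [hu]

theorem IsAssociatedGraded.symbolAt_mul_of_mem_shiftedFiltration
    (hF : IsAlgebraFiltration F) (hπ : IsAssociatedGraded F ℬ π) {e e' n : ℕ} {u v : U}
    (hu : u ∈ shiftedFiltration F (e + e') n) (hv : v ∈ F e') :
    symbolAt F π (n - e) (u * v) =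
      symbolAt F π (n - (e + e')) u * symbolAt F π e' v := by
  rcases le_or_gt (e + e') n with h | h
  · rw [mem_shiftedFiltration_of_le h] at hu
    rw [show n - e = n - (e + e') + e' by omega, hπ.symbolAt_mul hF hu hv]
  · rw [mem_shiftedFiltration_of_lt h] at hu
    simp [hu]

theorem IsAssociatedGraded.mem_shiftedFiltration_of_symbolAt_eq_zero
    (hπ : IsAssociatedGraded F ℬ π) {e n : ℕ} {u : U}
    (hu : u ∈ shiftedFiltration F e (n + 1)) (h : symbolAt F π (n + 1 - e) u = 0) :
    u ∈ shiftedFiltration F e n := by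
  rcases lt_trichotomy e (n + 1) with he | rfl | he
  · rw [mem_shiftedFiltration_of_le he.le, Nat.succ_sub (by omega)] at hu
    rw [mem_shiftedFiltration_of_le (by omega)]
    rw [Nat.succ_sub (by omega)] at h
    exact (hπ.symbolAt_succ_eq_zero_iff hu).1 h
  · rw [mem_shiftedFiltration_of_le le_rfl, Nat.sub_self] at hu
    rw [Nat.sub_self] at h
    rw [mem_shiftedFiltration_of_lt (by omega)]
    exact hπ.eq_zero_of_symbolAt_zero hu h
  · rw [mem_shiftedFiltration_of_lt he] at hu
    rw [mem_shiftedFiltration_of_lt (by omega), hu]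

/-- The syzygies between homogeneous elements are generated by homogeneous Koszul syzygies as
soon as all syzygies are Koszul. -/
theorem exists_homogeneous_alternating [GradedAlgebra ℬ] {t : ℕ} {f : Fin t → B} {d : Fin t → ℕ}
    (hf : ∀ i, f i ∈ ℬ (d i)) {n : ℕ} {a : Fin t → B} (ha : ∀ i, a i ∈ ℬ (n - d i))
    (ha0 : ∀ i, n < d i → a i = 0) {b : Fin t → Fin t → B} (hb0 : ∀ i, b i i = 0)
    (hb : ∀ i j, b i j = -b j i) (hab : ∀ i, a i = ∑ j, b i j * f j) :
    ∃ c : Fin t → Fin t → B, (∀ i, c i i = 0) ∧ (∀ i j, c i j = -c j i) ∧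
      (∀ i j, c i j ∈ ℬ (n - (d i + d j))) ∧ (∀ i j, n < d i + d j → c i j = 0) ∧
      ∀ i, a i = ∑ j, c i j * f j := by
  refine ⟨fun i j => if d i + d j ≤ n then
    (DirectSum.decompose ℬ (b i j) (n - (d i + d j)) : B) else 0, ?_, ?_, ?_, ?_, ?_⟩
  · intro i
    simp [hb0]
  · intro i j
    dsimp only
    rw [hb i j, add_comm (d j), DirectSum.decompose_neg]
    split_ifs
    · rfl
    · exact neg_zero.symm
  · intro i j
    dsimp only
    split_ifs
    · exact SetLike.coe_mem _
    · exact zero_mem _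
  · intro i j h
    exact if_neg h.not_ge
  · intro i
    rcases lt_or_ge n (d i) with h | h
    · rw [ha0 i h, Finset.sum_eq_zero]
      intro j _
      simp only [if_neg (show ¬d i + d j ≤ n by omega), zero_mul]
    · rw [← DirectSum.decompose_of_mem_same ℬ (ha i), hab i, DirectSum.decompose_sum,
        DFinsupp.finsetSum_apply, AddSubmonoidClass.coe_finsetSum]
      refine Finset.sum_congr rfl fun j _ => ?_
      rw [DirectSum.coe_decompose_mul_of_right_mem ℬ _ (hf j)]
      by_cases h' : d i + d j ≤ n
      · simp only [if_pos h', if_pos (show d j ≤ n - d i by omega)]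
        rw [Nat.sub_sub]
      · simp only [if_neg h', if_neg (show ¬d j ≤ n - d i by omega), zero_mul]

/-- If all syzygies between the symbols of the commuting elements `h i` are Koszul, the degrees
of the coefficients in a relation `∑ i, a i * h i = u` can be lowered until no
cancellation of symbols occurs. -/
theorem exists_lower_coefficients [GradedAlgebra ℬ]
    (hF : IsAlgebraFiltration F) (hπ : IsAssociatedGraded F ℬ π)
    {t : ℕ} {h : Fin t → U} {d : Fin t → ℕ}
    (hcomm : ∀ i j, Commute (h i) (h j)) (hd : ∀ i, h i ∈ F (d i))
    (hsyz : ∀ a : Fin t → B, ∑ i, a i * symbolAt F π (d i) (h i) = 0 →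
      ∃ b : Fin t → Fin t → B, (∀ i, b i i = 0) ∧ (∀ i j, b i j = -b j i) ∧
        ∀ i, a i = ∑ j, b i j * symbolAt F π (d j) (h j))
    {n : ℕ} {a : Fin t → U} (ha : ∀ i, a i ∈ shiftedFiltration F (d i) (n + 1))
    (hu : ∑ i, a i * h i ∈ F n) :
    ∃ a' : Fin t → U, (∀ i, a' i ∈ shiftedFiltration F (d i) n) ∧
      ∑ i, a' i * h i = ∑ i, a i * h i := by
  have ha' : ∀ i, a i ∈ shiftedFiltration F (0 + d i) (n + 1) := by simpa using ha
  have hmem : ∀ i, a i * h i ∈ F (n + 1) := fun i => by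
    simpa [mem_shiftedFiltration_of_le] using hF.mul_mem_shiftedFiltration (ha' i) (hd i)
  obtain ⟨b, hb0, hb, hab⟩ := hsyz (fun i => symbolAt F π (n + 1 - d i) (a i)) (by
    have hzero : symbolAt F π (n + 1) (∑ i, a i * h i) = 0 :=
      (hπ.symbolAt_succ_eq_zero_iff (sum_mem fun i _ => hmem i)).2 hu
    rw [symbolAt_sum _ fun i _ => hmem i] at hzero
    rw [← hzero]
    refine Finset.sum_congr rfl fun i _ => ?_
    simpa using (hπ.symbolAt_mul_of_mem_shiftedFiltration hF (ha' i) (hd i)).symm)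
  obtain ⟨c, hc0, hc, hcm, hcz, hac⟩ := exists_homogeneous_alternating
    (fun i => hπ.symbolAt_mem (d i) (h i)) (fun i => hπ.symbolAt_mem _ (a i))
    (fun i hi => by rw [(mem_shiftedFiltration_of_lt hi).1 (ha i), symbolAt_zero]) hb0 hb hab
  have hlift : ∀ i j, ∃ β ∈ shiftedFiltration F (d i + d j) (n + 1),
      symbolAt F π (n + 1 - (d i + d j)) β = c i j := fun i j => by
    rcases le_or_gt (d i + d j) (n + 1) with hij | hij
    · simpa only [mem_shiftedFiltration_of_le hij] using hπ.exists_symbolAt_eq (hcm i j)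
    · exact ⟨0, zero_mem _, by rw [hcz i j hij, symbolAt_zero]⟩
  choose l hl hlc using hlift
  let β : Fin t → Fin t → U := fun i j => if i < j then l i j else if j < i then -l j i else 0
  have hβ0 : ∀ i, β i i = 0 := fun i => by simp [β]
  have hβ : ∀ i j, β i j = -β j i := fun i j => by
    rcases lt_trichotomy i j with hij | rfl | hij
    · simp [β, hij, hij.not_gt]
    · simp [β]
    · simp [β, hij, hij.not_gt]
  have hβm : ∀ i j, β i j ∈ shiftedFiltration F (d i + d j) (n + 1) := fun i j => by
    simp only [β]
    split_ifs
    · exact hl i j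
    · rw [add_comm]
      exact neg_mem (hl j i)
    · exact zero_mem _
  have hmemF : ∀ {e : ℕ} {u : U}, u ∈ shiftedFiltration F e (n + 1) → u ∈ F (n + 1 - e) := by
    intro e u hu
    rcases le_or_gt e (n + 1) with he | he
    · rwa [mem_shiftedFiltration_of_le he] at hu
    · rw [(mem_shiftedFiltration_of_lt he).1 hu]
      exact zero_mem _
  have hβc : ∀ i j, symbolAt F π (n + 1 - (d i + d j)) (β i j) = c i j := fun i j => by
    rcases lt_trichotomy i j with hij | rfl | hij
    · simp only [β, if_pos hij, hlc]
    · rw [hβ0, hc0, symbolAt_zero]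
    · simp only [β, if_neg hij.not_gt, if_pos hij]
      rw [add_comm (d i), symbolAt_neg (hmemF (hl j i)), hlc, hc i j]
  have hprod : ∀ i j, β i j * h j ∈ shiftedFiltration F (d i) (n + 1) := fun i j =>
    hF.mul_mem_shiftedFiltration (hβm i j) (hd j)
  refine ⟨fun i => a i - ∑ j, β i j * h j, fun i => ?_, ?_⟩
  · refine hπ.mem_shiftedFiltration_of_symbolAt_eq_zero
      (sub_mem (ha i) (sum_mem fun j _ => hprod i j)) ?_
    rw [symbolAt_sub (hmemF (ha i)) (sum_mem fun j _ => hmemF (hprod i j)),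
      symbolAt_sum _ fun j _ => hmemF (hprod i j), hac i, sub_eq_zero]
    refine Finset.sum_congr rfl fun j _ => ?_
    rw [hπ.symbolAt_mul_of_mem_shiftedFiltration hF (hβm i j) (hd j), hβc]
  · simp only [sub_mul, Finset.sum_sub_distrib, sub_eq_self, Finset.sum_mul]
    rw [← Finset.sum_product']
    refine Finset.sum_involution (fun p _ => (p.2, p.1)) ?_ ?_ (by simp) (by simp)
    · rintro ⟨i, j⟩ _
      simp only [hβ i j, mul_assoc, (hcomm i j).eq, neg_mul, neg_add_cancel]
    · rintro ⟨i, j⟩ _ hne heq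
      obtain rfl : j = i := congrArg Prod.fst heq
      exact hne (by simp [hβ0])

/-- If all syzygies between the symbols of the commuting elements `h i` of positive degree are
Koszul, then the `h i` generate a proper left ideal. -/
theorem span_range_ne_top_of_syzygies [Nontrivial U] [GradedAlgebra ℬ]
    (hF : IsAlgebraFiltration F) (hπ : IsAssociatedGraded F ℬ π) {t : ℕ} {h : Fin t → U}
    {d : Fin t → ℕ} (hcomm : ∀ i j, Commute (h i) (h j)) (hd : ∀ i, h i ∈ F (d i))
    (hpos : ∀ i, 0 < d i)
    (hsyz : ∀ a : Fin t → B, ∑ i, a i * symbolAt F π (d i) (h i) = 0 →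
      ∃ b : Fin t → Fin t → B, (∀ i, b i i = 0) ∧ (∀ i j, b i j = -b j i) ∧
        ∀ i, a i = ∑ j, b i j * symbolAt F π (d j) (h j)) :
    Submodule.span U (Set.range h) ≠ ⊤ := by
  intro htop
  have h1 : (1 : U) ∈ Submodule.span U (Set.range h) := htop ▸ Submodule.mem_top
  obtain ⟨a, ha⟩ := (Submodule.mem_span_range_iff_exists_fun U).1 h1
  have hone : (1 : U) ∈ F 0 := by
    rw [hF.zero]
    exact Submodule.one_le.1 le_rfl
  have key : ∀ n (a : Fin t → U), (∀ i, a i ∈ shiftedFiltration F (d i) n) →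
      ∑ i, a i * h i = 1 → False := by
    intro n
    induction n with
    | zero =>
      intro a ha hsum
      refine zero_ne_one (α := U) ?_
      rw [← hsum, Finset.sum_eq_zero]
      intro i _
      rw [(mem_shiftedFiltration_of_lt (hpos i)).1 (ha i), zero_mul]
    | succ n ih =>
      intro a ha hsum
      obtain ⟨a', ha', hsum'⟩ := exists_lower_coefficients hF hπ hcomm hd hsyz ha
        (hsum ▸ hF.mono (Nat.zero_le n) hone)
      exact ih a' ha' (hsum'.trans hsum)
  have hex : ∀ i, ∃ m, a i ∈ F m := fun i =>
    (Submodule.mem_iSup_of_directed F hF.mono.directed_le).1 (hF.exhaustive ▸ Submodule.mem_top)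
  choose m hm using hex
  refine key (∑ j, (m j + d j)) a (fun i => ?_) (by simpa using ha)
  have hle : m i + d i ≤ ∑ j, (m j + d j) :=
    Finset.single_le_sum (f := fun j => m j + d j) (fun _ _ => Nat.zero_le _) (Finset.mem_univ i)
  rw [mem_shiftedFiltration_of_le (by omega)]
  exact hF.mono (by omega) (hm i)

end Filtered

/-- A proper left ideal containing all `g i - c i` yields a simple module with a common
eigenvector. -/
theorem exists_simple_module_of_span_ne_top {U : Type v} [Ring U] {ι : Type*} {g c : ι → U}
    (h : Submodule.span U (Set.range fun i => g i - c i) ≠ ⊤) :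
    ∃ (M : Type v) (_ : AddCommGroup M) (_ : Module U M) (m : M),
      IsSimpleModule U M ∧ Submodule.span U {m} = ⊤ ∧ ∀ i, g i • m = c i • m := by
  obtain ⟨J, hJ, hle⟩ := Ideal.exists_le_maximal _ h
  have hsimple : IsSimpleModule U (U ⧸ J) := isSimpleModule_iff_isCoatom.2 hJ.out
  refine ⟨U ⧸ J, inferInstance, inferInstance, Submodule.Quotient.mk 1, hsimple, ?_, fun i => ?_⟩
  · rw [eq_top_iff]
    intro x _
    obtain ⟨u, rfl⟩ := Submodule.Quotient.mk_surjective _ x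
    exact Submodule.mem_span_singleton.2 ⟨u, by rw [← Submodule.Quotient.mk_smul]; simp⟩
  · rw [← Submodule.Quotient.mk_smul, ← Submodule.Quotient.mk_smul, Submodule.Quotient.eq]
    simpa using hle (Submodule.subset_span ⟨i, rfl⟩)

/-- Let `U` be a filtered `k`-algebra whose associated graded algebra
`gr U` is a commutative affine Cohen–Macaulay `k`-algebra. If `g 1, …, g t` are mutually
commuting elements of `U` such that `V(ḡ 1, …, ḡ t) ⊆ Sp (gr U)` is equidimensional of
codimension `t`, then every character `μ ∈ Sp k[g 1, …, g t]` lifts to a simple left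
`U`-module: there is a simple left `U`-module `M` generated by `m ∈ M` with
`g i • m = μ(g i) • m` for all `i`. -/
theorem statement9 {k : Type u} {U : Type v} {B : Type w} [Field k] [IsAlgClosed k]
    [CharZero k] [Ring U] [Algebra k U] [CommRing B] [Algebra k B]
    [Algebra.FiniteType k B]
    (F : ℕ → Submodule k U) (hF : IsAlgebraFiltration F)
    (ℬ : ℕ → Submodule k B) [GradedAlgebra ℬ] (π : ∀ i : ℕ, F i →ₗ[k] B)
    (hπ : IsAssociatedGraded F ℬ π)
    (hCM : IsPaperCM k B)
    {t : ℕ} (g : Fin t → U) (hcomm : ∀ i j, Commute (g i) (g j))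
    (d : Fin t → ℕ) (hdF : ∀ i, g i ∈ F (d i))
    (hne : ∀ i, π (d i) ⟨g i, hdF i⟩ ≠ 0)
    (hequidim : EquidimOfCodim
      (spZeroLocus k (Set.range fun i => π (d i) ⟨g i, hdF i⟩)) t) :
    ∀ μ : ↥(Algebra.adjoin k (Set.range g)) →ₐ[k] k,
      ∃ (M : Type v) (_ : AddCommGroup M) (_ : Module U M) (m : M),
        IsSimpleModule U M ∧ Submodule.span U {m} = ⊤ ∧
          ∀ i, g i • m = (algebraMap k U (μ ⟨g i, Algebra.subset_adjoin (Set.mem_range_self i)⟩)) • m := by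
  intro μ
  obtain ⟨χ, hχ⟩ := hequidim.1
  have hχ0 : ∀ i, χ (π (d i) ⟨g i, hdF i⟩) = 0 := fun i => hχ _ ⟨i, rfl⟩
  have hone : (1 : U) ∈ F 0 := by
    rw [hF.zero]
    exact Submodule.one_le.1 le_rfl
  have hscalar : ∀ r : k, algebraMap k U r ∈ F 0 := fun r => by
    rw [Algebra.algebraMap_eq_smul_one]
    exact (F 0).smul_mem r hone
  have hnontrivialB : Nontrivial B := χ.toRingHom.domain_nontrivial
  have hnontrivial : Nontrivial U := by
    refine nontrivial_of_ne 1 0 fun h => one_ne_zero (α := B) ?_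
    rw [← hπ.map_one hone, show (⟨1, hone⟩ : F 0) = 0 from Subtype.ext h, map_zero]
  have hsymbol : ∀ i, symbolAt F π (d i) (g i) = π (d i) ⟨g i, hdF i⟩ := fun i =>
    symbolAt_of_mem (hdF i)
  have hpos : ∀ i, 0 < d i := by
    intro i
    refine Nat.pos_of_ne_zero fun h0 => hne i ?_
    have hg : g i ∈ F 0 := h0 ▸ hdF i
    obtain ⟨r, hr⟩ := Submodule.mem_one.1 (hF.zero ▸ hg)
    have hs : symbolAt F π 0 (g i) = algebraMap k B r := by
      rw [symbolAt_of_mem hg, Algebra.algebraMap_eq_smul_one, ← hπ.map_one hone, ← map_smul]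
      congr 1
      ext
      simp [← hr, Algebra.algebraMap_eq_smul_one]
    have hi : algebraMap k B r = π (d i) ⟨g i, hdF i⟩ := by rw [← hs, ← hsymbol, h0]
    have hr0 : r = 0 := by simpa [← hi] using hχ0 i
    rw [← hi, hr0, map_zero]
  set c : Fin t → U := fun i =>
    algebraMap k U (μ ⟨g i, Algebra.subset_adjoin (Set.mem_range_self i)⟩)
  have hc0 : ∀ i, c i ∈ F 0 := fun i => hscalar _
  have hcd : ∀ i, c i ∈ F (d i) := fun i => hF.mono (Nat.zero_le _) (hc0 i)
  have hshift : ∀ i, symbolAt F π (d i) (g i - c i) = π (d i) ⟨g i, hdF i⟩ := by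
    intro i
    rw [symbolAt_sub (hdF i) (hcd i), hsymbol, sub_eq_self]
    obtain ⟨e, he⟩ := Nat.exists_eq_succ_of_ne_zero (hpos i).ne'
    have hci := hcd i
    rw [he] at hci ⊢
    exact (hπ.symbolAt_succ_eq_zero_iff hci).2 (hF.mono (Nat.zero_le _) (hc0 i))
  have hlocus : spZeroLocus k
      ((Ideal.span (Set.range fun i => π (d i) ⟨g i, hdF i⟩) : Ideal B) : Set B) =
      spZeroLocus k (Set.range fun i => π (d i) ⟨g i, hdF i⟩) := by
    ext ψ
    refine ⟨fun h f hf => h f (Ideal.subset_span hf), fun h f hf => ?_⟩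
    have hle : Ideal.span (Set.range fun i => π (d i) ⟨g i, hdF i⟩) ≤ RingHom.ker ψ :=
      Ideal.span_le.2 h
    exact hle hf
  obtain ⟨n, hn, ⟨x, hxI, hx⟩, -⟩ := hCM (Ideal.span (Set.range fun i => π (d i) ⟨g i, hdF i⟩))
    (fun htop => by
      have h1 : χ ∈ spZeroLocus k ((⊤ : Ideal B) : Set B) := htop ▸ hlocus.symm ▸ hχ
      exact one_ne_zero (α := k) ((map_one χ).symm.trans (h1 1 trivial)))
  rw [hlocus] at hn
  have htn : t ≤ n := le_of_equidimOfCodim (topologicalKrullDim_characters_lt_top k B) hequidim hn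
  refine exists_simple_module_of_span_ne_top (span_range_ne_top_of_syzygies hF hπ
    (h := fun i => g i - c i) (fun i j => ?_) (fun i => sub_mem (hdF i) (hcd i)) hpos ?_)
  · have hcu : ∀ i u, Commute (c i) u := fun i u => Algebra.commutes _ u
    exact ((hcomm i j).sub_right (hcu j _).symm).sub_left (hcu i _)
  · simpa only [hshift] using exists_alternating_of_sum_mul_eq_zero _ x hx hxI htn

end
end
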